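/- arXiv:2103.09089 — 5 statements merged into one kernel-verified Lean document; each statement's English description precedes it below -/
import Mathlib

section
/- For any norm ‖·‖ on ℂ^d and any bounded subset S ⊂ M_d(ℂ), one has ρ(S) ≤ inf_{g ∈ GL_d(ℂ)} ‖gSg⁻¹‖ ≤ d·ρ(S). -/
open scoped Pointwise
open Filter

/-- A norm on `ℂ^d`, given as a plain function with the norm axioms. -/
def IsCNorm {d : ℕ} (v : (Fin d → ℂ) → ℝ) : Prop :=
  (∀ x, 0 ≤ v x) ∧ (∀ x, v x = 0 ↔ x = 0) ∧
  (∀ (a : ℂ) (x), v (a • x) = ‖a‖ * v x) ∧ (∀ x y, v (x + y) ≤ v x + v y)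

/-- Operator norm on matrices induced by the norm `v` on `ℂ^d`. -/
noncomputable def opNorm {d : ℕ} (v : (Fin d → ℂ) → ℝ) (A : Matrix (Fin d) (Fin d) ℂ) : ℝ :=
  sSup {c : ℝ | ∃ x : Fin d → ℂ, v x ≤ 1 ∧ c = v (A.mulVec x)}

/-- Norm of a set of matrices: `sup_{s ∈ S} ‖s‖`. -/
noncomputable def setOpNorm {d : ℕ} (v : (Fin d → ℂ) → ℝ)
    (S : Set (Matrix (Fin d) (Fin d) ℂ)) : ℝ :=
  sSup (opNorm v '' S)

/-- The sup norm on `ℂ^d`, used as reference norm to define the joint spectral radius. -/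
noncomputable def stdNorm {d : ℕ} (x : Fin d → ℂ) : ℝ := ‖x‖

/-- The joint spectral radius `ρ(S) = inf_{n ≥ 1} ‖Sⁿ‖^{1/n}`. -/
noncomputable def jsr {d : ℕ} (S : Set (Matrix (Fin d) (Fin d) ℂ)) : ℝ :=
  ⨅ n : ℕ, setOpNorm stdNorm (S ^ (n + 1)) ^ (1 / (n + 1 : ℝ))

/-- The spectral radius of a matrix: the largest modulus of an eigenvalue. -/
noncomputable def specRad {d : ℕ} (A : Matrix (Fin d) (Fin d) ℂ) : ℝ :=
  sSup ((fun μ : ℂ => ‖μ‖) '' spectrum ℂ A)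

/-- `Λ(S) = sup_{s ∈ S} Λ(s)`. -/
noncomputable def lamSet {d : ℕ} (S : Set (Matrix (Fin d) (Fin d) ℂ)) : ℝ :=
  sSup (specRad '' S)

/-- Boundedness of a set of matrices. -/
def MatBdd {d : ℕ} (S : Set (Matrix (Fin d) (Fin d) ℂ)) : Prop :=
  ∃ C : ℝ, ∀ A ∈ S, ∀ i j, ‖A i j‖ ≤ C

/-- `S` is irreducible: it preserves no nonzero proper subspace of `ℂ^d`. -/
def IsIrred {d : ℕ} (S : Set (Matrix (Fin d) (Fin d) ℂ)) : Prop :=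
  ∀ W : Submodule ℂ (Fin d → ℂ), (∀ A ∈ S, ∀ x ∈ W, A.mulVec x ∈ W) → W = ⊥ ∨ W = ⊤

/-- Type synonym of `ℂ^d` carrying the norm `v`. -/
def NSp {d : ℕ} (v : (Fin d → ℂ) → ℝ) (_ : IsCNorm v) : Type := Fin d → ℂ

instance NSp.instAddCommGroup {d : ℕ} (v : (Fin d → ℂ) → ℝ) (hv : IsCNorm v) :
    AddCommGroup (NSp v hv) := inferInstanceAs (AddCommGroup (Fin d → ℂ))

instance NSp.instModule {d : ℕ} (v : (Fin d → ℂ) → ℝ) (hv : IsCNorm v) :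
    Module ℂ (NSp v hv) := inferInstanceAs (Module ℂ (Fin d → ℂ))

instance NSp.instFinite {d : ℕ} (v : (Fin d → ℂ) → ℝ) (hv : IsCNorm v) :
    FiniteDimensional ℂ (NSp v hv) := inferInstanceAs (Module.Finite ℂ (Fin d → ℂ))

noncomputable instance NSp.instNACG {d : ℕ} (v : (Fin d → ℂ) → ℝ) (hv : IsCNorm v) :
    NormedAddCommGroup (NSp v hv) :=
  AddGroupNorm.toNormedAddCommGroup
    { toFun := fun x => v x
      map_zero' := (hv.2.1 0).2 rfl
      add_le' := fun x y => hv.2.2.2 x y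
      neg' := fun x => by
        have := hv.2.2.1 (-1) x
        have h2 : ((-1 : ℂ) • (x : Fin d → ℂ)) = (-x : NSp v hv) := neg_one_smul ℂ (x : NSp v hv)
        have h3 : v (-x : NSp v hv) = ‖(-1 : ℂ)‖ * v x := (congrArg v h2).symm.trans this
        rw [norm_neg, norm_one, one_mul] at h3
        exact h3
      eq_zero_of_map_eq_zero' := fun x h => (hv.2.1 x).1 h }

theorem NSp.norm_def {d : ℕ} (v : (Fin d → ℂ) → ℝ) (hv : IsCNorm v) (x : NSp v hv) :
    ‖x‖ = v x := rfl

noncomputable instance NSp.instNS {d : ℕ} (v : (Fin d → ℂ) → ℝ) (hv : IsCNorm v) :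
    NormedSpace ℂ (NSp v hv) where
  norm_smul_le a x := (hv.2.2.1 a x).le

/-- The identity as a linear equivalence. -/
def NSp.equiv {d : ℕ} (v : (Fin d → ℂ) → ℝ) (hv : IsCNorm v) :
    (Fin d → ℂ) ≃ₗ[ℂ] NSp v hv := LinearEquiv.refl ℂ (Fin d → ℂ)

theorem cnorm_equiv {d : ℕ} (v : (Fin d → ℂ) → ℝ) (hv : IsCNorm v) :
    ∃ K : ℝ, 0 < K ∧ ∀ x, v x ≤ K * ‖x‖ ∧ ‖x‖ ≤ K * v x := by
  let f := LinearMap.toContinuousLinearMap (NSp.equiv v hv).toLinearMap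
  let g := LinearMap.toContinuousLinearMap (NSp.equiv v hv).symm.toLinearMap
  refine ⟨‖f‖ + ‖g‖ + 1, by positivity, fun x => ⟨?_, ?_⟩⟩
  · have h : v x ≤ ‖f‖ * ‖x‖ := f.le_opNorm x
    have := norm_nonneg g
    nlinarith [norm_nonneg x]
  · have h : ‖x‖ ≤ ‖g‖ * v x := g.le_opNorm (NSp.equiv v hv x)
    have := norm_nonneg f
    nlinarith [hv.1 x]

theorem real_aux (a b : ℝ) (n : ℕ) (ha : 0 ≤ a)
    (h : ∀ t : ℝ, 0 < t → 1 + t * b ≤ (1 + t * a) ^ n) : b ≤ n * a := by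
  have hd : HasDerivAt (fun t : ℝ => (1 + t * a) ^ n - t * b) (n * a - b) 0 := by
    have h1 : HasDerivAt (fun t : ℝ => 1 + t * a) a 0 := by
      simpa using ((hasDerivAt_id (0:ℝ)).mul_const a).const_add 1
    have h2 := h1.pow n
    have h3 : HasDerivAt (fun t : ℝ => t * b) b 0 := by
      simpa using (hasDerivAt_id (0:ℝ)).mul_const b
    have h5 : (n : ℝ) * (1 + 0 * a) ^ (n - 1) * a - b = n * a - b := by simp
    have h4 : HasDerivAt (fun t : ℝ => (1 + t * a) ^ n - t * b)
      ((n : ℝ) * (1 + 0 * a) ^ (n - 1) * a - b) 0 := h2.sub h3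
    rwa [h5] at h4
  have ht := hd.hasDerivWithinAt (s := Set.Ioi 0)
  rw [hasDerivWithinAt_iff_tendsto_slope' (by simp)] at ht
  have : 0 ≤ n * a - b := by
    refine ge_of_tendsto ht ?_
    filter_upwards [self_mem_nhdsWithin] with t ht
    have ht : 0 < t := ht
    have := h t ht
    rw [slope_def_field]
    apply div_nonneg
    · simp; linarith
    · simpa using ht.le
  linarith

theorem banach_mazur {E F : Type} [NormedAddCommGroup E] [NormedSpace ℂ E]
    [NormedAddCommGroup F] [NormedSpace ℂ F] [FiniteDimensional ℂ E] [FiniteDimensional ℂ F]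
    (e : E ≃ₗ[ℂ] F) : ∃ g : E ≃ₗ[ℂ] F,
      ∀ x, ‖g x‖ ≤ ‖x‖ ∧ ‖x‖ ≤ Module.finrank ℂ E * ‖g x‖ := by
  have : ProperSpace (E →L[ℂ] F) := FiniteDimensional.proper ℂ _
  let ec : F →L[ℂ] E := LinearMap.toContinuousLinearMap e.symm.toLinearMap
  let φ : (E →L[ℂ] F) → ℝ := fun g => ‖(ec.comp g).det‖
  have hφ : Continuous φ := by
    have h1 : Continuous fun g : E →L[ℂ] F => ec.comp g := by fun_prop
    exact (ContinuousLinearMap.continuous_det.comp h1).norm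
  obtain ⟨g, hg, hmax⟩ := (isCompact_closedBall (0 : E →L[ℂ] F) 1).exists_isMaxOn
    ⟨0, by simp⟩ hφ.continuousOn
  have hgn : ‖g‖ ≤ 1 := by simpa using hg
  have φsmul : ∀ (c : ℂ) (h : E →L[ℂ] F), φ (c • h) = ‖c‖ ^ Module.finrank ℂ E * φ h := by
    intro c h
    simp only [φ, ContinuousLinearMap.comp_smul, ContinuousLinearMap.det,
      ContinuousLinearMap.toLinearMap_smul, LinearMap.det_smul, norm_mul, norm_pow]
  -- homogeneous version of maximality
  have hmax' : ∀ (h : E →L[ℂ] F) (M : ℝ), 0 < M → ‖h‖ ≤ M →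
      φ h ≤ M ^ Module.finrank ℂ E * φ g := by
    intro h M hM hh
    have h1 : ((M:ℂ)⁻¹ • h) ∈ Metric.closedBall (0 : E →L[ℂ] F) 1 := by
      simp only [mem_closedBall_zero_iff, norm_smul, norm_inv, Complex.norm_real, Real.norm_eq_abs,
        abs_of_pos hM]
      rw [inv_mul_le_iff₀ hM]; simpa using hh
    have h2 := hmax h1
    simp only [Set.mem_ofPred_eq] at h2
    have h3 : h = (M:ℂ) • ((M:ℂ)⁻¹ • h) := by
      rw [smul_smul, mul_inv_cancel₀ (by exact_mod_cast hM.ne'), one_smul]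
    rw [h3, φsmul]
    simp only [Complex.norm_real, Real.norm_eq_abs, abs_of_pos hM]
    gcongr
  have hgpos : 0 < φ g := by
    let e' : E →L[ℂ] F := LinearMap.toContinuousLinearMap e.toLinearMap
    have h1 := hmax' e' (‖e'‖ + 1) (by positivity) (by linarith)
    have h2 : φ e' = 1 := by
      have : ec.comp e' = ContinuousLinearMap.id ℂ E := by
        ext x; simp [ec, e']
      change ‖(ec.comp e').det‖ = 1
      rw [this]
      simp [ContinuousLinearMap.det]
    rw [h2] at h1
    by_contra hc
    have h0 : φ g = 0 := le_antisymm (not_lt.1 hc) (norm_nonneg _)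
    rw [h0] at h1; norm_num at h1
  have hdet : LinearMap.det (e.symm.toLinearMap ∘ₗ g.toLinearMap) ≠ 0 := by
    intro h0
    apply hgpos.ne'
    change ‖LinearMap.det (e.symm.toLinearMap ∘ₗ g.toLinearMap)‖ = 0
    rw [h0, norm_zero]
  let q : E ≃ₗ[ℂ] E := LinearEquiv.ofIsUnitDet (v := Module.finBasis ℂ E)
    (v' := Module.finBasis ℂ E) (f := e.symm.toLinearMap ∘ₗ g.toLinearMap)
    (by rw [LinearMap.det_toMatrix]; exact hdet.isUnit)
  have hq : ∀ x, e (q x) = g x := by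
    intro x
    have : q x = e.symm (g x) := rfl
    rw [this, e.apply_symm_apply]
  refine ⟨q.trans e, fun x => ?_⟩
  rw [LinearEquiv.trans_apply, hq]
  refine ⟨by simpa using (g.le_opNorm x).trans (mul_le_mul_of_nonneg_right hgn (norm_nonneg x)), ?_⟩
  apply real_aux _ _ _ (norm_nonneg _)
  intro t ht
  obtain ⟨f, hf1, hf2⟩ := exists_dual_vector'' ℂ x
  let h : E →L[ℂ] F := g + (t : ℂ) • (f.smulRight (g x))
  have hh : ‖h‖ ≤ 1 + t * ‖g x‖ := by
    refine (norm_add_le _ _).trans ?_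
    rw [norm_smul, ContinuousLinearMap.norm_smulRight_apply, Complex.norm_real, Real.norm_eq_abs,
      abs_of_pos ht]
    gcongr
    nlinarith [norm_nonneg (g x)]
  have h1 := hmax' h _ (by positivity) hh
  have h2 : φ h = (1 + t * ‖x‖) * φ g := by
    have : (ec.comp h).toLinearMap = (ec.comp g).toLinearMap ∘ₗ
        (LinearMap.transvection ((t:ℂ) • f.toLinearMap) x) := by
      ext y
      rw [LinearMap.comp_apply, LinearMap.transvection.apply]
      change ec (g y + (t : ℂ) • (f y • g x)) = ec (g (y + ((t : ℂ) * f y) • x))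
      rw [map_add g, map_smul g, smul_smul]
    simp only [φ, ContinuousLinearMap.det]
    rw [this, LinearMap.det_comp, norm_mul, mul_comm]
    congr 1
    rw [LinearMap.transvection.det]
    simp only [LinearMap.smul_apply, ContinuousLinearMap.coe_coe, hf2, smul_eq_mul]
    have : (1 + (t:ℂ) * ((‖x‖ : ℝ) : ℂ)) = ((1 + t * ‖x‖ : ℝ) : ℂ) := by push_cast; rfl
    erw [this]
    rw [Complex.norm_real, Real.norm_eq_abs, abs_of_nonneg (by positivity)]
  rw [h2] at h1
  exact le_of_mul_le_mul_right h1 hgpos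

attribute [local instance] Matrix.linftyOpNormedRing Matrix.linftyOpNormedAddCommGroup

theorem matBdd_norm {d : ℕ} {S : Set (Matrix (Fin d) (Fin d) ℂ)} (hS : MatBdd S) :
    ∃ C : ℝ, 0 ≤ C ∧ ∀ A ∈ S, ‖A‖ ≤ C := by
  obtain ⟨C, hC⟩ := hS
  refine ⟨d * |C|, by positivity, fun A hA => ?_⟩
  have h : ∀ x, ‖A.mulVec x‖ ≤ d * |C| * ‖x‖ := by
    intro x
    rw [pi_norm_le_iff_of_nonneg (by positivity)]
    intro i
    calc ‖A.mulVec x i‖ ≤ ∑ j, ‖A i j * x j‖ := by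
          simp only [Matrix.mulVec, dotProduct]; exact norm_sum_le _ _
      _ ≤ ∑ j : Fin d, |C| * ‖x‖ := by
          refine Finset.sum_le_sum fun j _ => ?_
          rw [norm_mul]
          gcongr
          · exact (hC A hA i j).trans (le_abs_self C)
          · exact norm_le_pi_norm x j
      _ = _ := by simp; ring
  rw [Matrix.linfty_opNorm_eq_opNorm]
  exact ContinuousLinearMap.opNorm_le_bound _ (by positivity) h

theorem pow_norm_bdd {d : ℕ} {S : Set (Matrix (Fin d) (Fin d) ℂ)} {C : ℝ} (hC0 : 0 ≤ C)
    (hC : ∀ A ∈ S, ‖A‖ ≤ C) (n : ℕ) : ∃ M : ℝ, 0 ≤ M ∧ ∀ A ∈ S ^ n, ‖A‖ ≤ M := by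
  induction n with
  | zero => exact ⟨‖(1 : Matrix (Fin d) (Fin d) ℂ)‖, norm_nonneg _, fun A hA => by
      simp at hA; simp [hA]⟩
  | succ n ih =>
    obtain ⟨M, hM0, hM⟩ := ih
    refine ⟨M * C, by positivity, fun A hA => ?_⟩
    rw [pow_succ] at hA
    obtain ⟨B, hB, s, hs, rfl⟩ := Set.mem_mul.1 hA
    exact (norm_mul_le _ _).trans (mul_le_mul (hM B hB) (hC s hs) (norm_nonneg _) hM0)

theorem stdNorm_isCNorm {d : ℕ} : IsCNorm (stdNorm (d := d)) :=
  ⟨fun _ => norm_nonneg _, fun _ => norm_eq_zero, fun a x => norm_smul a x,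
    fun x y => norm_add_le x y⟩

theorem opNorm_set_bdd {d : ℕ} {v : (Fin d → ℂ) → ℝ} {K : ℝ}
    (hK : 0 < K ∧ ∀ x, v x ≤ K * ‖x‖ ∧ ‖x‖ ≤ K * v x) (A : Matrix (Fin d) (Fin d) ℂ)
    {c : ℝ} (hc : ∃ x : Fin d → ℂ, v x ≤ 1 ∧ c = v (A.mulVec x)) : c ≤ K * ‖A‖ * K := by
  obtain ⟨x, hx, rfl⟩ := hc
  have hKp := hK.1
  calc v (A.mulVec x) ≤ K * ‖A.mulVec x‖ := (hK.2 _).1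
    _ ≤ K * (‖A‖ * ‖x‖) := by gcongr; exact Matrix.linfty_opNorm_mulVec A x
    _ ≤ K * (‖A‖ * (K * 1)) := by
        gcongr
        exact (hK.2 x).2.trans (by gcongr)
    _ = _ := by ring

theorem opNorm_nonneg {d : ℕ} {v : (Fin d → ℂ) → ℝ} (hv : IsCNorm v)
    (A : Matrix (Fin d) (Fin d) ℂ) : 0 ≤ opNorm v A :=
  Real.sSup_nonneg (by rintro _ ⟨x, _, rfl⟩; exact hv.1 _)

theorem setOpNorm_nonneg {d : ℕ} {v : (Fin d → ℂ) → ℝ} (hv : IsCNorm v)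
    (S : Set (Matrix (Fin d) (Fin d) ℂ)) : 0 ≤ setOpNorm v S :=
  Real.sSup_nonneg (by rintro _ ⟨x, _, rfl⟩; exact opNorm_nonneg hv _)

theorem le_opNorm {d : ℕ} {v : (Fin d → ℂ) → ℝ} (hv : IsCNorm v)
    (A : Matrix (Fin d) (Fin d) ℂ) (x : Fin d → ℂ) : v (A.mulVec x) ≤ opNorm v A * v x := by
  obtain ⟨K, hK⟩ := cnorm_equiv v hv
  by_cases hx : x = 0
  · subst hx
    have : v 0 = 0 := (hv.2.1 0).2 rfl
    simp [this]
  have hpos : 0 < v x := lt_of_le_of_ne (hv.1 x) (fun h => hx ((hv.2.1 x).1 h.symm))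
  have hn : ‖((v x : ℂ))⁻¹‖ = (v x)⁻¹ := by
    rw [norm_inv, Complex.norm_real, Real.norm_eq_abs, abs_of_pos hpos]
  have h1 : v (A.mulVec ((v x : ℂ)⁻¹ • x)) ≤ opNorm v A := by
    refine le_csSup ⟨_, fun c hc => opNorm_set_bdd hK A hc⟩ ⟨_, ?_, rfl⟩
    rw [hv.2.2.1, hn, inv_mul_cancel₀ hpos.ne']
  rw [Matrix.mulVec_smul, hv.2.2.1, hn, inv_mul_le_iff₀ hpos] at h1
  linarith

theorem opNorm_le {d : ℕ} {v : (Fin d → ℂ) → ℝ} (hv : IsCNorm v)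
    {A : Matrix (Fin d) (Fin d) ℂ} {M : ℝ} (hM : 0 ≤ M) (h : ∀ x, v (A.mulVec x) ≤ M * v x) :
    opNorm v A ≤ M := by
  refine Real.sSup_le ?_ hM
  rintro _ ⟨x, hx, rfl⟩
  exact (h x).trans (by nlinarith [hv.1 x])

theorem setOpNorm_le {d : ℕ} {v : (Fin d → ℂ) → ℝ} (hv : IsCNorm v)
    {S : Set (Matrix (Fin d) (Fin d) ℂ)} {M : ℝ} (hM : 0 ≤ M)
    (h : ∀ A ∈ S, ∀ x, v (A.mulVec x) ≤ M * v x) : setOpNorm v S ≤ M := by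
  refine Real.sSup_le ?_ hM
  rintro _ ⟨A, hA, rfl⟩
  exact opNorm_le hv hM (h A hA)

theorem le_setOpNorm {d : ℕ} {v : (Fin d → ℂ) → ℝ} (hv : IsCNorm v)
    {S : Set (Matrix (Fin d) (Fin d) ℂ)} {C : ℝ} (hC : ∀ A ∈ S, ‖A‖ ≤ C)
    {A : Matrix (Fin d) (Fin d) ℂ} (hA : A ∈ S) (x : Fin d → ℂ) :
    v (A.mulVec x) ≤ setOpNorm v S * v x := by
  obtain ⟨K, hK⟩ := cnorm_equiv v hv
  have hKp := hK.1
  refine (le_opNorm hv A x).trans (mul_le_mul_of_nonneg_right ?_ (hv.1 x))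
  refine le_csSup ⟨K * C * K, ?_⟩ ⟨A, hA, rfl⟩
  rintro _ ⟨B, hB, rfl⟩
  have hC0 : 0 ≤ C := (norm_nonneg B).trans (hC B hB)
  refine Real.sSup_le (fun c hc => (opNorm_set_bdd hK B hc).trans ?_) (by positivity)
  gcongr
  exact hC B hB

theorem jsr_le_of_norm {d : ℕ} {u : (Fin d → ℂ) → ℝ} (hu : IsCNorm u)
    {S : Set (Matrix (Fin d) (Fin d) ℂ)} {c : ℝ} (hc : 0 ≤ c)
    (h : ∀ A ∈ S, ∀ x, u (A.mulVec x) ≤ c * u x) : jsr S ≤ c := by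
  obtain ⟨K, hK0, hK⟩ := cnorm_equiv u hu
  have hp : ∀ n : ℕ, ∀ A ∈ S ^ n, ∀ x, u (A.mulVec x) ≤ c ^ n * u x := by
    intro n
    induction n with
    | zero => intro A hA x; simp at hA; simp [hA]
    | succ n ih =>
      intro A hA x
      rw [pow_succ] at hA
      obtain ⟨B, hB, s, hs, rfl⟩ := Set.mem_mul.1 hA
      rw [← Matrix.mulVec_mulVec]
      calc _ ≤ c ^ n * u (s.mulVec x) := ih B hB _
        _ ≤ c ^ n * (c * u x) := by gcongr; exact h s hs x
        _ = _ := by ring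
  have hs : ∀ n : ℕ, setOpNorm stdNorm (S ^ (n+1)) ≤ K ^ 2 * c ^ (n+1) := by
    intro n
    refine setOpNorm_le stdNorm_isCNorm (by positivity) fun A hA x => ?_
    calc ‖A.mulVec x‖ ≤ K * u (A.mulVec x) := (hK _).2
      _ ≤ K * (c ^ (n+1) * u x) := by gcongr; exact hp _ A hA x
      _ ≤ K * (c ^ (n+1) * (K * ‖x‖)) := by gcongr; exact (hK x).1
      _ = K ^ 2 * c ^ (n+1) * ‖x‖ := by ring
  have hj : ∀ n : ℕ, jsr S ≤ (K ^ 2) ^ (1 / (n + 1 : ℝ)) * c := by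
    intro n
    have h0 : jsr S ≤ setOpNorm stdNorm (S ^ (n + 1)) ^ (1 / (n + 1 : ℝ)) := by
      refine ciInf_le ⟨0, ?_⟩ n
      rintro _ ⟨m, rfl⟩
      exact Real.rpow_nonneg (setOpNorm_nonneg stdNorm_isCNorm _) _
    refine h0.trans ?_
    refine (Real.rpow_le_rpow (setOpNorm_nonneg stdNorm_isCNorm _) (hs n) (by positivity)).trans ?_
    rw [Real.mul_rpow (by positivity) (by positivity)]
    have : (c ^ (n+1)) ^ (1 / (n + 1 : ℝ)) = c := by
      have := Real.pow_rpow_inv_natCast hc (Nat.succ_ne_zero n)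
      simpa using this
    rw [this]
  have ht : Tendsto (fun n : ℕ => (K ^ 2) ^ (1 / (n + 1 : ℝ)) * c) atTop (nhds c) := by
    have h1 := tendsto_one_div_add_atTop_nhds_zero_nat (𝕜 := ℝ)
    have h2 := (Real.continuousAt_const_rpow (a := K ^ 2) (b := 0) (by positivity)).tendsto.comp h1
    simpa using h2.mul_const c
  exact ge_of_tendsto' ht hj

theorem exists_norm {d : ℕ} {S : Set (Matrix (Fin d) (Fin d) ℂ)} (hS : MatBdd S) {r : ℝ}
    (hr : jsr S < r) : ∃ w : (Fin d → ℂ) → ℝ, IsCNorm w ∧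
      ∀ A ∈ S, ∀ x, w (A.mulVec x) ≤ r * w x := by
  obtain ⟨C, hC0, hC⟩ := matBdd_norm hS
  have hj0 : 0 ≤ jsr S := Real.iInf_nonneg fun m =>
    Real.rpow_nonneg (setOpNorm_nonneg stdNorm_isCNorm _) _
  have hr0 : 0 < r := hj0.trans_lt hr
  obtain ⟨n, hn⟩ := exists_lt_of_ciInf_lt hr
  have hn' : setOpNorm stdNorm (S ^ (n+1)) ≤ r ^ (n+1) := by
    have h1 := Real.rpow_le_rpow (Real.rpow_nonneg (setOpNorm_nonneg stdNorm_isCNorm _) _) hn.le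
      (z := ((n + 1 : ℕ) : ℝ)) (by positivity)
    rw [← Real.rpow_mul (setOpNorm_nonneg stdNorm_isCNorm _), Real.rpow_natCast] at h1
    have : (1 / (n + 1 : ℝ)) * ((n+1 : ℕ) : ℝ) = 1 := by push_cast; field_simp
    rwa [this, Real.rpow_one] at h1
  let p : ℕ → (Fin d → ℂ) → ℝ := fun k x => ⨆ A : ↥(S ^ k), ‖A.1.mulVec x‖
  have p_nonneg : ∀ k x, 0 ≤ p k x := fun k x => Real.iSup_nonneg fun A => norm_nonneg _
  have le_p : ∀ k x, ∀ A ∈ S ^ k, ‖A.mulVec x‖ ≤ p k x := by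
    intro k x A hA
    obtain ⟨M, hM0, hM⟩ := pow_norm_bdd hC0 hC k
    refine le_ciSup (f := fun A : ↥(S ^ k) => ‖A.1.mulVec x‖) ⟨M * ‖x‖, ?_⟩ ⟨A, hA⟩
    rintro _ ⟨B, rfl⟩
    exact (Matrix.linfty_opNorm_mulVec B.1 x).trans (by gcongr; exact hM _ B.2)
  have p_le : ∀ k x (M : ℝ), 0 ≤ M → (∀ A ∈ S ^ k, ‖A.mulVec x‖ ≤ M) → p k x ≤ M :=
    fun k x M hM h => Real.iSup_le (fun A => h A.1 A.2) hM
  have p_zero : ∀ x, p 0 x = ‖x‖ := by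
    intro x
    apply le_antisymm
    · exact p_le 0 x _ (norm_nonneg _) fun A hA => by simp at hA; simp [hA]
    · simpa using le_p 0 x 1 (by simp)
  have p_smul_le : ∀ k (a : ℂ) x, p k (a • x) ≤ ‖a‖ * p k x := by
    intro k a x
    refine p_le k _ _ (mul_nonneg (norm_nonneg _) (p_nonneg _ _)) fun A hA => ?_
    rw [Matrix.mulVec_smul, norm_smul]
    gcongr
    exact le_p k x A hA
  have p_smul : ∀ k (a : ℂ) x, p k (a • x) = ‖a‖ * p k x := by
    intro k a x
    refine le_antisymm (p_smul_le k a x) ?_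
    by_cases ha : a = 0
    · simp [ha, p_nonneg]
    have := p_smul_le k a⁻¹ (a • x)
    rw [smul_smul, inv_mul_cancel₀ ha, one_smul, norm_inv,
      le_inv_mul_iff₀ (norm_pos_iff.2 ha)] at this
    exact this
  have p_add : ∀ k x y, p k (x + y) ≤ p k x + p k y := by
    intro k x y
    refine p_le k _ _ (add_nonneg (p_nonneg _ _) (p_nonneg _ _)) fun A hA => ?_
    rw [Matrix.mulVec_add]
    exact (norm_add_le _ _).trans (add_le_add (le_p k x A hA) (le_p k y A hA))
  have p_step : ∀ k, ∀ s ∈ S, ∀ x, p k (s.mulVec x) ≤ p (k+1) x := by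
    intro k s hs x
    refine p_le k _ _ (p_nonneg _ _) fun A hA => ?_
    rw [Matrix.mulVec_mulVec]
    exact le_p (k+1) x _ (by rw [pow_succ]; exact Set.mul_mem_mul hA hs)
  have p_last : ∀ x, p (n+1) x ≤ r ^ (n+1) * p 0 x := by
    intro x
    obtain ⟨M, hM0, hM⟩ := pow_norm_bdd hC0 hC (n+1)
    rw [p_zero]
    refine p_le _ _ _ (by positivity) fun A hA => ?_
    have := le_setOpNorm stdNorm_isCNorm hM hA x
    exact this.trans (mul_le_mul_of_nonneg_right hn' (norm_nonneg _))
  let w : (Fin d → ℂ) → ℝ := fun x => ∑ k ∈ Finset.range (n+1), (r⁻¹) ^ k * p k x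
  have w_nonneg : ∀ x, 0 ≤ w x := fun x => Finset.sum_nonneg fun k _ =>
    mul_nonneg (by positivity) (p_nonneg _ _)
  have w_ge : ∀ x, ‖x‖ ≤ w x := by
    intro x
    have := Finset.single_le_sum (f := fun k => (r⁻¹) ^ k * p k x) (s := Finset.range (n+1))
      (fun k _ => mul_nonneg (by positivity) (p_nonneg _ _)) (Finset.mem_range.2 (Nat.succ_pos n))
    simp only [pow_zero, one_mul, p_zero] at this
    exact this
  have w_smul : ∀ (a : ℂ) x, w (a • x) = ‖a‖ * w x := by
    intro a x
    simp only [w, p_smul, Finset.mul_sum]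
    exact Finset.sum_congr rfl fun k _ => by ring
  refine ⟨w, ⟨w_nonneg, fun x => ⟨fun h => ?_, fun h => ?_⟩, w_smul, fun x y => ?_⟩, ?_⟩
  · exact norm_le_zero_iff.1 ((w_ge x).trans h.le)
  · have := w_smul 0 x
    simpa [h] using this
  · simp only [w, ← Finset.sum_add_distrib, ← mul_add]
    exact Finset.sum_le_sum fun k _ => mul_le_mul_of_nonneg_left (p_add k x y) (by positivity)
  · intro s hs x
    calc w (s.mulVec x) ≤ ∑ k ∈ Finset.range (n+1), (r⁻¹) ^ k * p (k+1) x :=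
          Finset.sum_le_sum fun k _ => mul_le_mul_of_nonneg_left (p_step k s hs x) (by positivity)
      _ = r * ∑ k ∈ Finset.range (n+1), (r⁻¹) ^ (k+1) * p (k+1) x := by
          rw [Finset.mul_sum]
          refine Finset.sum_congr rfl fun k _ => ?_
          rw [pow_succ]; field_simp
      _ ≤ r * w x := by
          refine mul_le_mul_of_nonneg_left ?_ hr0.le
          have h1 := Finset.sum_range_succ' (fun k => (r⁻¹) ^ k * p k x) (n+1)
          rw [Finset.sum_range_succ] at h1
          have h2 : (r⁻¹) ^ (n+1) * p (n+1) x ≤ p 0 x := by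
            rw [inv_pow, inv_mul_le_iff₀ (by positivity)]
            exact p_last x
          simp only [pow_zero, one_mul] at h1
          have h3 : w x = ∑ k ∈ Finset.range (n+1), (r⁻¹) ^ k * p k x := rfl
          linarith

theorem exists_unit {d : ℕ} {v w : (Fin d → ℂ) → ℝ} (hv : IsCNorm v) (hw : IsCNorm w) :
    ∃ g : (Matrix (Fin d) (Fin d) ℂ)ˣ, ∀ x,
      v ((g : Matrix (Fin d) (Fin d) ℂ).mulVec x) ≤ w x ∧
      w x ≤ d * v ((g : Matrix (Fin d) (Fin d) ℂ).mulVec x) := by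
  obtain ⟨g, hg⟩ := banach_mazur ((NSp.equiv w hw).symm.trans (NSp.equiv v hv))
  let g' : (Fin d → ℂ) ≃ₗ[ℂ] (Fin d → ℂ) := (NSp.equiv w hw).trans (g.trans (NSp.equiv v hv).symm)
  have hfr : Module.finrank ℂ (NSp w hw) = d := by
    rw [← (NSp.equiv w hw).finrank_eq]; simp
  rw [hfr] at hg
  refine ⟨⟨LinearMap.toMatrix' g'.toLinearMap, LinearMap.toMatrix' g'.symm.toLinearMap, ?_, ?_⟩, ?_⟩
  · rw [← LinearMap.toMatrix'_comp]; simp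
  · rw [← LinearMap.toMatrix'_comp]; simp
  · intro x
    have : (LinearMap.toMatrix' g'.toLinearMap).mulVec x = g' x := by
      rw [← Matrix.toLin'_apply, Matrix.toLin'_toMatrix']; rfl
    simp only [this]
    exact hg (NSp.equiv w hw x)

/-- for any norm on `ℂ^d` and bounded `S ⊂ M_d(ℂ)`:
`ρ(S) ≤ inf_{g ∈ GL_d(ℂ)} ‖gSg⁻¹‖ ≤ d·ρ(S)`. -/
theorem stmt_2 {d : ℕ} (v : (Fin d → ℂ) → ℝ) (hv : IsCNorm v)
    (S : Set (Matrix (Fin d) (Fin d) ℂ)) (hS : MatBdd S) :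
    jsr S ≤ sInf {c : ℝ | ∃ g : (Matrix (Fin d) (Fin d) ℂ)ˣ,
        c = setOpNorm v ((fun A => (g : Matrix (Fin d) (Fin d) ℂ) * A * ((g⁻¹ : _ˣ) : Matrix (Fin d) (Fin d) ℂ)) '' S)} ∧
    sInf {c : ℝ | ∃ g : (Matrix (Fin d) (Fin d) ℂ)ˣ,
        c = setOpNorm v ((fun A => (g : Matrix (Fin d) (Fin d) ℂ) * A * ((g⁻¹ : _ˣ) : Matrix (Fin d) (Fin d) ℂ)) '' S)}
      ≤ d * jsr S := by
  have bdd : ∀ c ∈ {c : ℝ | ∃ g : (Matrix (Fin d) (Fin d) ℂ)ˣ,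
        c = setOpNorm v ((fun A => (g : Matrix (Fin d) (Fin d) ℂ) * A * ((g⁻¹ : _ˣ) : Matrix (Fin d) (Fin d) ℂ)) '' S)}, 0 ≤ c := by
    rintro _ ⟨g, rfl⟩
    exact setOpNorm_nonneg hv _
  obtain ⟨C, hC0, hC⟩ := matBdd_norm hS
  constructor
  · refine le_csInf ⟨_, 1, rfl⟩ ?_
    rintro _ ⟨g, rfl⟩
    have hu : IsCNorm (fun x => v ((g : Matrix (Fin d) (Fin d) ℂ).mulVec x)) := by
      refine ⟨fun x => hv.1 _, fun x => ?_, fun a x => ?_, fun x y => ?_⟩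
      · rw [hv.2.1]
        refine ⟨fun h => ?_, fun h => by simp [h]⟩
        have h2 := congrArg (((g⁻¹ : _ˣ) : Matrix (Fin d) (Fin d) ℂ).mulVec) h
        simpa using h2
      · simp only [Matrix.mulVec_smul, hv.2.2.1]
      · simp only [Matrix.mulVec_add, hv.2.2.2]
    refine jsr_le_of_norm hu (setOpNorm_nonneg hv _) fun A hA x => ?_
    have hb : ∀ B ∈ ((fun A => (g : Matrix (Fin d) (Fin d) ℂ) * A * ((g⁻¹ : _ˣ) : Matrix (Fin d) (Fin d) ℂ)) '' S),
        ‖B‖ ≤ ‖(g : Matrix (Fin d) (Fin d) ℂ)‖ * C * ‖((g⁻¹ : _ˣ) : Matrix (Fin d) (Fin d) ℂ)‖ := by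
      rintro _ ⟨A, hA, rfl⟩
      refine (norm_mul_le _ _).trans ?_
      gcongr
      refine (norm_mul_le _ _).trans ?_
      gcongr
      exact hC A hA
    have := le_setOpNorm hv hb ⟨A, hA, rfl⟩ ((g : Matrix (Fin d) (Fin d) ℂ).mulVec x)
    simpa [Matrix.mulVec_mulVec, mul_assoc] using this
  · have key : ∀ r : ℝ, jsr S < r → sInf {c : ℝ | ∃ g : (Matrix (Fin d) (Fin d) ℂ)ˣ,
        c = setOpNorm v ((fun A => (g : Matrix (Fin d) (Fin d) ℂ) * A * ((g⁻¹ : _ˣ) : Matrix (Fin d) (Fin d) ℂ)) '' S)}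
        ≤ d * r := by
      intro r hr
      have hj0 : 0 ≤ jsr S := Real.iInf_nonneg fun m =>
        Real.rpow_nonneg (setOpNorm_nonneg stdNorm_isCNorm _) _
      have hr0 : 0 < r := hj0.trans_lt hr
      obtain ⟨w, hw, hwS⟩ := exists_norm hS hr
      obtain ⟨g, hg⟩ := exists_unit hv hw
      refine (csInf_le ⟨0, bdd⟩ ⟨g, rfl⟩).trans ?_
      refine setOpNorm_le hv (by positivity) ?_
      rintro _ ⟨A, hA, rfl⟩ x
      have h1 := (hg (A.mulVec (((g⁻¹ : _ˣ) : Matrix (Fin d) (Fin d) ℂ).mulVec x))).1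
      have h2 := hwS A hA (((g⁻¹ : _ˣ) : Matrix (Fin d) (Fin d) ℂ).mulVec x)
      have h3 := (hg (((g⁻¹ : _ˣ) : Matrix (Fin d) (Fin d) ℂ).mulVec x)).2
      simp only [Matrix.mulVec_mulVec, Units.mul_inv, Matrix.one_mulVec] at h1 h2 h3
      simp only [mul_assoc]
      calc _ ≤ _ := h1
        _ ≤ _ := h2
        _ ≤ r * (d * v x) := by gcongr
        _ = _ := by ring
    have ht : Tendsto (fun r : ℝ => (d : ℝ) * r) (nhdsWithin (jsr S) (Set.Ioi (jsr S)))
        (nhds (d * jsr S)) :=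
      ((continuous_const.mul continuous_id).tendsto _).mono_left nhdsWithin_le_nhds
    refine ge_of_tendsto ht ?_
    filter_upwards [self_mem_nhdsWithin] with r hr
    exact key r hr
end

section
/- For a bounded subset S ⊂ M_d(ℂ), ρ(S) = 0 if and only if the subalgebra ℂ[S] of M_d(ℂ) generated by S is nilpotent (equivalently, S^d = {0}). -/
open scoped Pointwise
open Filter

theorem mulVec_norm_le_aux {d : ℕ} {A : Matrix (Fin d) (Fin d) ℂ} {C : ℝ}
    (hA : ∀ i j, ‖A i j‖ ≤ C) (hC : 0 ≤ C) (x : Fin d → ℂ) :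
    ‖A.mulVec x‖ ≤ d * C * ‖x‖ := by
  refine (pi_norm_le_iff_of_nonneg (by positivity)).2 fun i => ?_
  calc ‖A.mulVec x i‖ = ‖∑ j, A i j * x j‖ := rfl
    _ ≤ ∑ j, ‖A i j * x j‖ := norm_sum_le _ _
    _ ≤ ∑ _j : Fin d, C * ‖x‖ := by
        refine Finset.sum_le_sum fun j _ => ?_
        rw [norm_mul]
        exact mul_le_mul (hA i j) (norm_le_pi_norm x j) (norm_nonneg _) hC
    _ = d * C * ‖x‖ := by simp [mul_assoc]

theorem MatBdd.nonneg_bound {d : ℕ} {S : Set (Matrix (Fin d) (Fin d) ℂ)} (hS : MatBdd S) :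
    ∃ C : ℝ, 0 ≤ C ∧ ∀ A ∈ S, ∀ i j, ‖A i j‖ ≤ C := by
  obtain ⟨C, hC⟩ := hS
  exact ⟨max C 0, le_max_right _ _, fun A hA i j => (hC A hA i j).trans (le_max_left _ _)⟩

theorem MatBdd.pow_aux {d : ℕ} {S : Set (Matrix (Fin d) (Fin d) ℂ)} (hS : MatBdd S) (n : ℕ) :
    MatBdd (S ^ n) := by
  induction n with
  | zero =>
    refine ⟨1, fun A hA i j => ?_⟩
    rw [pow_zero, Set.mem_one] at hA
    subst hA
    rw [Matrix.one_apply]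
    split_ifs <;> simp
  | succ n ih =>
    obtain ⟨C, hC0, hC⟩ := hS.nonneg_bound
    obtain ⟨D, hD0, hD⟩ := ih.nonneg_bound
    refine ⟨d * (D * C), fun A hA i j => ?_⟩
    rw [pow_succ] at hA
    obtain ⟨P, hP, Q, hQ, rfl⟩ := Set.mem_mul.1 hA
    rw [Matrix.mul_apply]
    calc ‖∑ k, P i k * Q k j‖ ≤ ∑ k, ‖P i k * Q k j‖ := norm_sum_le _ _
      _ ≤ ∑ _k : Fin d, D * C := by
        refine Finset.sum_le_sum fun k _ => ?_
        rw [norm_mul]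
        exact mul_le_mul (hD P hP i k) (hC Q hQ k j) (norm_nonneg _) hD0
      _ = d * (D * C) := by simp

theorem setOpNorm_nonneg_aux {d : ℕ} (S : Set (Matrix (Fin d) (Fin d) ℂ)) :
    0 ≤ setOpNorm stdNorm S := by
  refine Real.sSup_nonneg ?_
  rintro _ ⟨A, _, rfl⟩
  refine Real.sSup_nonneg ?_
  rintro _ ⟨x, _, rfl⟩
  exact norm_nonneg _

theorem norm_mulVec_le_setOpNorm {d : ℕ} {S : Set (Matrix (Fin d) (Fin d) ℂ)} (hS : MatBdd S)
    {A : Matrix (Fin d) (Fin d) ℂ} (hA : A ∈ S) (x : Fin d → ℂ) :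
    ‖A.mulVec x‖ ≤ setOpNorm stdNorm S * ‖x‖ := by
  obtain ⟨C, hC0, hC⟩ := hS.nonneg_bound
  have hb : ∀ B ∈ S, ∀ y : Fin d → ℂ, stdNorm y ≤ 1 → stdNorm (B.mulVec y) ≤ d * C := by
    intro B hB y hy
    refine (mulVec_norm_le_aux (hC B hB) hC0 y).trans ?_
    exact mul_le_of_le_one_right (by positivity) hy
  have h1 : ∀ y : Fin d → ℂ, stdNorm y ≤ 1 → ‖A.mulVec y‖ ≤ setOpNorm stdNorm S := by
    intro y hy
    have h2 : ‖A.mulVec y‖ ≤ opNorm stdNorm A := by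
      refine le_csSup ⟨d * C, ?_⟩ ⟨y, hy, rfl⟩
      rintro _ ⟨z, hz, rfl⟩
      exact hb A hA z hz
    refine h2.trans (le_csSup ⟨d * C, ?_⟩ ⟨A, hA, rfl⟩)
    rintro _ ⟨B, hB, rfl⟩
    refine Real.sSup_le ?_ (by positivity)
    rintro _ ⟨z, hz, rfl⟩
    exact hb B hB z hz
  by_cases hx : x = 0
  · subst hx; simp
  have hx' : 0 < ‖x‖ := norm_pos_iff.2 hx
  have h3 := h1 (((‖x‖ : ℂ)⁻¹) • x) (by
    rw [stdNorm, norm_smul]; simp [hx'.ne'])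
  rw [Matrix.mulVec_smul, norm_smul, norm_inv, Complex.norm_real, norm_norm,
    inv_mul_le_iff₀ hx'] at h3
  linarith

theorem iterate_bound {d : ℕ} (S : Set (Matrix (Fin d) (Fin d) ℂ)) (s : Finset (Fin d → ℂ))
    (K : ℝ) (hK : 0 ≤ K)
    (h : ∀ e ∈ s, ∃ c : (S × s) →₀ ℂ, (∑ p ∈ c.support, ‖c p‖ ≤ K) ∧
      ∑ p ∈ c.support, c p • (p.1.1.mulVec p.2.1) = e) (M : ℝ) (hM : 0 ≤ M) (n : ℕ) :
    ∀ X : Matrix (Fin d) (Fin d) ℂ, (∀ T ∈ S ^ n, ∀ e ∈ s, ‖(X * T).mulVec e‖ ≤ M) →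
      ∀ e ∈ s, ‖X.mulVec e‖ ≤ K ^ n * M := by
  induction n with
  | zero =>
    intro X hX e he
    simpa using hX 1 (by simp) e he
  | succ n ih =>
    intro X hX e he
    have h1 : ∀ A ∈ S, ∀ e ∈ s, ‖(X * A).mulVec e‖ ≤ K ^ n * M := by
      intro A hA
      refine ih (X * A) fun T hT e he => ?_
      rw [mul_assoc]
      refine hX (A * T) ?_ e he
      rw [pow_succ']
      exact Set.mul_mem_mul hA hT
    obtain ⟨c, hc, hce⟩ := h e he
    calc ‖X.mulVec e‖ = ‖∑ p ∈ c.support, c p • (X * p.1.1).mulVec p.2.1‖ := by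
          rw [← hce, Matrix.mulVec_sum]
          simp [Matrix.mulVec_smul, Matrix.mulVec_mulVec]
      _ ≤ ∑ p ∈ c.support, ‖c p • (X * p.1.1).mulVec p.2.1‖ := norm_sum_le _ _
      _ ≤ ∑ p ∈ c.support, ‖c p‖ * (K ^ n * M) := by
          refine Finset.sum_le_sum fun p _ => ?_
          rw [norm_smul]
          exact mul_le_mul_of_nonneg_left (h1 _ p.1.2 _ p.2.2) (norm_nonneg _)
      _ = (∑ p ∈ c.support, ‖c p‖) * (K ^ n * M) := by rw [Finset.sum_mul]
      _ ≤ K * (K ^ n * M) := mul_le_mul_of_nonneg_right hc (by positivity)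
      _ = K ^ (n + 1) * M := by ring

/-- The span of `S W`. -/
def stepSub {d : ℕ} (S : Set (Matrix (Fin d) (Fin d) ℂ)) (W : Submodule ℂ (Fin d → ℂ)) :
    Submodule ℂ (Fin d → ℂ) :=
  Submodule.span ℂ {y | ∃ A ∈ S, ∃ x ∈ W, A.mulVec x = y}

theorem stepSub_mono {d : ℕ} (S : Set (Matrix (Fin d) (Fin d) ℂ))
    {W W' : Submodule ℂ (Fin d → ℂ)} (h : W ≤ W') : stepSub S W ≤ stepSub S W' := by
  refine Submodule.span_mono ?_
  rintro y ⟨A, hA, x, hx, rfl⟩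
  exact ⟨A, hA, x, h hx, rfl⟩

theorem mem_stepSub {d : ℕ} {S : Set (Matrix (Fin d) (Fin d) ℂ)}
    {W : Submodule ℂ (Fin d → ℂ)} {A : Matrix (Fin d) (Fin d) ℂ} (hA : A ∈ S) {x : Fin d → ℂ}
    (hx : x ∈ W) : A.mulVec x ∈ stepSub S W :=
  Submodule.subset_span ⟨A, hA, x, hx, rfl⟩

theorem eq_bot_of_stepSub_eq {d : ℕ} {S : Set (Matrix (Fin d) (Fin d) ℂ)} (hS : MatBdd S)
    (h0 : jsr S = 0) {W : Submodule ℂ (Fin d → ℂ)} (hW : W ≤ stepSub S W) : W = ⊥ := by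
  classical
  obtain ⟨s, hs⟩ : W.FG := IsNoetherian.noetherian W
  by_contra hne
  obtain ⟨e, he, he0⟩ : ∃ e ∈ s, e ≠ 0 := by
    by_contra hcon
    push Not at hcon
    apply hne
    rw [← hs, Submodule.span_eq_bot]
    exact fun x hx => hcon x hx
  have hle : stepSub S W ≤ Submodule.span ℂ
      (Set.range fun p : S × s => p.1.1.mulVec p.2.1) := by
    refine Submodule.span_le.2 ?_
    rintro _ ⟨A, hA, x, hx, rfl⟩
    rw [← hs] at hx
    change A.mulVec x ∈ Submodule.span ℂ (Set.range fun p : S × s => p.1.1.mulVec p.2.1)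
    induction hx using Submodule.span_induction with
    | mem x hx => exact Submodule.subset_span ⟨(⟨A, hA⟩, ⟨x, hx⟩), rfl⟩
    | zero => simp
    | add x y _ _ h1 h2 => rw [Matrix.mulVec_add]; exact add_mem h1 h2
    | smul a x _ h1 => rw [Matrix.mulVec_smul]; exact Submodule.smul_mem _ _ h1
  have hex : ∀ e : s, ∃ c : (S × s) →₀ ℂ,
      ∑ p ∈ c.support, c p • (p.1.1.mulVec p.2.1) = e.1 := by
    intro e
    have h1 : e.1 ∈ W := hs ▸ Submodule.subset_span e.2
    obtain ⟨c, hc⟩ := Finsupp.mem_span_range_iff_exists_finsupp.1 (hle (hW h1))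
    exact ⟨c, hc⟩
  choose c hc using hex
  set K : ℝ := 1 + ∑ e : s, ∑ p ∈ (c e).support, ‖c e p‖ with hKdef
  have hK1 : 1 ≤ K := by
    rw [hKdef]
    have : 0 ≤ ∑ e : s, ∑ p ∈ (c e).support, ‖c e p‖ :=
      Finset.sum_nonneg fun _ _ => Finset.sum_nonneg fun _ _ => norm_nonneg _
    linarith
  have hK : ∀ e ∈ s, ∃ c : (S × s) →₀ ℂ, (∑ p ∈ c.support, ‖c p‖ ≤ K) ∧
      ∑ p ∈ c.support, c p • (p.1.1.mulVec p.2.1) = e := by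
    intro e he
    refine ⟨c ⟨e, he⟩, ?_, hc ⟨e, he⟩⟩
    have := Finset.single_le_sum (f := fun e : s => ∑ p ∈ (c e).support, ‖c e p‖)
      (fun _ _ => Finset.sum_nonneg fun _ _ => norm_nonneg _) (Finset.mem_univ ⟨e, he⟩)
    linarith
  set B : ℝ := ∑ f ∈ s, ‖f‖ with hB
  have hBs : ∀ f ∈ s, ‖f‖ ≤ B := fun f hf =>
    Finset.single_le_sum (f := fun f => ‖f‖) (fun _ _ => norm_nonneg _) hf
  have hepos : 0 < ‖e‖ := norm_pos_iff.2 he0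
  have hBpos : 0 < B := hepos.trans_le (hBs e he)
  have hKpos : 0 < K := by linarith
  have key : ∀ n : ℕ, ‖e‖ ≤ K ^ n * (setOpNorm stdNorm (S ^ n) * B) := by
    intro n
    have hN := setOpNorm_nonneg_aux (S ^ n)
    have := iterate_bound S s K (by linarith) hK (setOpNorm stdNorm (S ^ n) * B)
      (by positivity) n 1 (fun T hT f hf => by
        rw [one_mul]
        exact (norm_mulVec_le_setOpNorm (hS.pow_aux n) hT f).trans
          (mul_le_mul_of_nonneg_left (hBs f hf) hN)) e he
    simpa using this
  set q : ℝ := ‖e‖ / B with hq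
  have hq0 : 0 < q := by positivity
  have hq1 : q ≤ 1 := (div_le_one hBpos).2 (hBs e he)
  have hlow : q / K ≤ jsr S := by
    refine le_ciInf fun n => ?_
    have hN := setOpNorm_nonneg_aux (S ^ (n + 1))
    have h1 : (q / K) ^ (n + 1) ≤ setOpNorm stdNorm (S ^ (n + 1)) := by
      rw [div_pow, div_le_iff₀ (by positivity)]
      have h2 : q ^ (n + 1) ≤ q := pow_le_of_le_one hq0.le hq1 (by omega)
      refine h2.trans ?_
      rw [hq, div_le_iff₀ hBpos]
      have := key (n + 1)
      linarith
    have h3 := Real.rpow_le_rpow (by positivity) h1 (by positivity : (0 : ℝ) ≤ 1 / (n + 1 : ℝ))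
    have h4 := Real.pow_rpow_inv_natCast (by positivity : 0 ≤ q / K) (Nat.succ_ne_zero n)
    push_cast at h4
    rw [one_div] at h3 ⊢
    simp only [Nat.succ_eq_add_one, Nat.cast_add, Nat.cast_one] at h4
    rwa [h4] at h3
  have : 0 < q / K := by positivity
  linarith

/-- The chain `V ⊇ SV ⊇ S²V ⊇ …`. -/
def chainSub {d : ℕ} (S : Set (Matrix (Fin d) (Fin d) ℂ)) : ℕ → Submodule ℂ (Fin d → ℂ)
  | 0 => ⊤
  | n + 1 => stepSub S (chainSub S n)

theorem chainSub_succ_le {d : ℕ} (S : Set (Matrix (Fin d) (Fin d) ℂ)) (n : ℕ) :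
    chainSub S (n + 1) ≤ chainSub S n := by
  induction n with
  | zero => exact le_top
  | succ n ih => exact stepSub_mono S ih

theorem chainSub_finrank {d : ℕ} {S : Set (Matrix (Fin d) (Fin d) ℂ)} (hS : MatBdd S)
    (h0 : jsr S = 0) (n : ℕ) :
    chainSub S n = ⊥ ∨ Module.finrank ℂ (chainSub S n) + n ≤ d := by
  induction n with
  | zero =>
    right
    change Module.finrank ℂ (⊤ : Submodule ℂ (Fin d → ℂ)) + 0 ≤ d
    rw [finrank_top]; simp
  | succ n ih =>
    by_cases hb : chainSub S n = ⊥
    · left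
      exact le_bot_iff.1 (hb ▸ chainSub_succ_le S n)
    · right
      have h1 := ih.resolve_left hb
      have hlt : chainSub S (n + 1) < chainSub S n :=
        lt_of_le_not_ge (chainSub_succ_le S n) fun h => hb (eq_bot_of_stepSub_eq hS h0 h)
      have := Submodule.finrank_lt_finrank_of_lt hlt
      omega

theorem chainSub_eq_bot {d : ℕ} {S : Set (Matrix (Fin d) (Fin d) ℂ)} (hS : MatBdd S)
    (h0 : jsr S = 0) : chainSub S d = ⊥ := by
  rcases chainSub_finrank hS h0 d with h | h
  · exact h
  · exact Submodule.finrank_eq_zero.1 (by omega)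

theorem adjoin_chain {d : ℕ} {S : Set (Matrix (Fin d) (Fin d) ℂ)}
    {T : Matrix (Fin d) (Fin d) ℂ} (hT : T ∈ NonUnitalAlgebra.adjoin ℂ S) (n : ℕ) :
    ∀ x ∈ chainSub S n, T.mulVec x ∈ chainSub S (n + 1) := by
  induction hT using NonUnitalAlgebra.adjoin_induction with
  | mem A hA => exact fun x hx => mem_stepSub hA hx
  | add A B _ _ hA hB =>
    intro x hx
    rw [Matrix.add_mulVec]
    exact add_mem (hA x hx) (hB x hx)
  | zero => intro x _; simp
  | mul A B _ _ hA hB =>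
    intro x hx
    rw [← Matrix.mulVec_mulVec]
    exact hA _ (chainSub_succ_le S n (hB x hx))
  | smul a A _ hA =>
    intro x hx
    rw [Matrix.smul_mulVec]
    exact Submodule.smul_mem _ _ (hA x hx)

theorem adjoin_pow_chain {d : ℕ} {S : Set (Matrix (Fin d) (Fin d) ℂ)} (n : ℕ) :
    ∀ T ∈ ((NonUnitalAlgebra.adjoin ℂ S : NonUnitalSubalgebra ℂ (Matrix (Fin d) (Fin d) ℂ)) :
      Set (Matrix (Fin d) (Fin d) ℂ)) ^ n, ∀ x, T.mulVec x ∈ chainSub S n := by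
  induction n with
  | zero => intro T _ x; exact Submodule.mem_top
  | succ n ih =>
    intro T hT x
    rw [pow_succ'] at hT
    obtain ⟨A, hA, B, hB, rfl⟩ := Set.mem_mul.1 hT
    rw [← Matrix.mulVec_mulVec]
    exact adjoin_chain hA n _ (ih B hB x)

theorem adjoin_pow_zero {d : ℕ} {S : Set (Matrix (Fin d) (Fin d) ℂ)} {n : ℕ}
    (h : chainSub S n = ⊥) :
    ((NonUnitalAlgebra.adjoin ℂ S : NonUnitalSubalgebra ℂ (Matrix (Fin d) (Fin d) ℂ)) :
      Set (Matrix (Fin d) (Fin d) ℂ)) ^ n ⊆ {0} := by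
  intro T hT
  rw [Set.mem_singleton_iff]
  refine Matrix.ext_of_mulVec_single fun i => ?_
  have := adjoin_pow_chain n T hT (Pi.single i 1)
  rw [h, Submodule.mem_bot] at this
  rw [this, Matrix.zero_mulVec]

theorem jsr_zero_of_pow {d : ℕ} {S : Set (Matrix (Fin d) (Fin d) ℂ)} {n : ℕ}
    (h : S ^ (n + 1) ⊆ {0}) : jsr S = 0 := by
  have hz : setOpNorm stdNorm (S ^ (n + 1)) = 0 := by
    refine le_antisymm (Real.sSup_le ?_ le_rfl) (setOpNorm_nonneg_aux _)
    rintro _ ⟨A, hA, rfl⟩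
    obtain rfl : A = 0 := h hA
    refine Real.sSup_le ?_ le_rfl
    rintro _ ⟨x, _, rfl⟩
    simp [stdNorm]
  have hnn : ∀ m : ℕ, 0 ≤ setOpNorm stdNorm (S ^ (m + 1)) ^ (1 / (m + 1 : ℝ)) :=
    fun m => Real.rpow_nonneg (setOpNorm_nonneg_aux _) _
  refine le_antisymm ?_ (Real.iInf_nonneg hnn)
  refine (ciInf_le ⟨0, ?_⟩ n).trans ?_
  · rintro _ ⟨m, rfl⟩
    exact hnn m
  · rw [hz, Real.zero_rpow (by positivity)]

/-- `ρ(S) = 0` iff the subalgebra `ℂ[S]` generated by `S` is nilpotent,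
equivalently iff `S^d = {0}`. -/
theorem stmt_5 {d : ℕ} (S : Set (Matrix (Fin d) (Fin d) ℂ)) (hS : MatBdd S) :
    (jsr S = 0 ↔
      ∃ n : ℕ, 0 < n ∧
        ((NonUnitalAlgebra.adjoin ℂ S : NonUnitalSubalgebra ℂ (Matrix (Fin d) (Fin d) ℂ)) :
            Set (Matrix (Fin d) (Fin d) ℂ)) ^ n ⊆ {0}) ∧
    (jsr S = 0 ↔ S ^ d ⊆ {0}) := by
  have hsub : S ⊆ ((NonUnitalAlgebra.adjoin ℂ S :
      NonUnitalSubalgebra ℂ (Matrix (Fin d) (Fin d) ℂ)) : Set (Matrix (Fin d) (Fin d) ℂ)) :=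
    NonUnitalAlgebra.subset_adjoin ℂ
  refine ⟨⟨fun h => ⟨d + 1, Nat.succ_pos d, ?_⟩, ?_⟩, ⟨fun h => ?_, fun h => ?_⟩⟩
  · refine adjoin_pow_zero (le_bot_iff.1 ?_)
    exact chainSub_eq_bot hS h ▸ chainSub_succ_le S d
  · rintro ⟨n, hn, h⟩
    obtain ⟨m, rfl⟩ := Nat.exists_eq_succ_of_ne_zero hn.ne'
    exact jsr_zero_of_pow ((Set.pow_subset_pow_left hsub).trans h)
  · exact (Set.pow_subset_pow_left hsub).trans (adjoin_pow_zero (chainSub_eq_bot hS h))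
  · refine jsr_zero_of_pow (n := d) ?_
    rw [pow_succ]
    intro T hT
    obtain ⟨A, hA, B, hB, rfl⟩ := Set.mem_mul.1 hT
    obtain rfl : A = 0 := h hA
    simp
end

section
/- (Barabanov norm) If S ⊂ M_d(ℂ) is bounded and irreducible, then there is a norm v on ℂ^d such that for all x ∈ ℂ^d, sup_{s∈S} v(sx) = ρ(S)·v(x). -/
open scoped Pointwise
open Filter

namespace BarabanovAux

variable {d : ℕ} {S : Set (Matrix (Fin d) (Fin d) ℂ)}

theorem entry_bound {A : Matrix (Fin d) (Fin d) ℂ} {C : ℝ} (hC : ∀ i j, ‖A i j‖ ≤ C)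
    (h0 : 0 ≤ C) (x : Fin d → ℂ) : ‖A.mulVec x‖ ≤ (d * C) * ‖x‖ := by
  rw [pi_norm_le_iff_of_nonneg (by positivity)]
  intro i
  calc ‖A.mulVec x i‖ = ‖∑ j, A i j * x j‖ := rfl
    _ ≤ ∑ j, ‖A i j * x j‖ := norm_sum_le _ _
    _ ≤ ∑ _j : Fin d, C * ‖x‖ := by
        refine Finset.sum_le_sum fun j _ => ?_
        rw [norm_mul]
        exact mul_le_mul (hC i j) (norm_le_pi_norm x j) (norm_nonneg _) h0
    _ = (d * C) * ‖x‖ := by simp [mul_assoc]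

theorem opNorm_le {A : Matrix (Fin d) (Fin d) ℂ} {c : ℝ} (hc : 0 ≤ c)
    (h : ∀ x, ‖A.mulVec x‖ ≤ c * ‖x‖) : opNorm stdNorm A ≤ c := by
  refine Real.sSup_le ?_ hc
  rintro _ ⟨x, hx, rfl⟩
  simp only [stdNorm] at hx ⊢
  exact (h x).trans (by nlinarith)

theorem le_opNorm (A : Matrix (Fin d) (Fin d) ℂ) (x : Fin d → ℂ) :
    ‖A.mulVec x‖ ≤ opNorm stdNorm A * ‖x‖ := by
  by_cases hx : x = 0
  · simp [hx]
  have hpos : 0 < ‖x‖ := norm_pos_iff.2 hx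
  have hb : BddAbove {c : ℝ | ∃ x : Fin d → ℂ, stdNorm x ≤ 1 ∧ c = stdNorm (A.mulVec x)} := by
    let C : ℝ := ∑ i, ∑ j, ‖A i j‖
    have h0 : 0 ≤ C := by positivity
    have hC : ∀ i j, ‖A i j‖ ≤ C := fun i j =>
      (Finset.single_le_sum (f := fun j => ‖A i j‖) (fun _ _ => norm_nonneg _)
        (Finset.mem_univ j)).trans
      (Finset.single_le_sum (f := fun i => ∑ j, ‖A i j‖) (fun _ _ => by positivity)
        (Finset.mem_univ i))
    refine ⟨d * C, ?_⟩
    rintro _ ⟨y, hy, rfl⟩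
    simp only [stdNorm] at hy ⊢
    have h1 : 0 ≤ d * C := by positivity
    exact (entry_bound hC h0 y).trans (by nlinarith)
  have := le_csSup hb ⟨((‖x‖⁻¹ : ℝ) : ℂ) • x, by
    simp [stdNorm, norm_smul, hpos.ne'], rfl⟩
  have h2 : stdNorm (A.mulVec (((‖x‖⁻¹ : ℝ) : ℂ) • x)) = ‖x‖⁻¹ * ‖A.mulVec x‖ := by
    simp [stdNorm, Matrix.mulVec_smul, norm_smul]
  rw [h2] at this
  change _ ≤ opNorm stdNorm A at this
  rw [inv_mul_le_iff₀ hpos] at this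
  linarith

theorem opNorm_nonneg (A : Matrix (Fin d) (Fin d) ℂ) : 0 ≤ opNorm stdNorm A := by
  refine Real.sSup_nonneg ?_
  rintro _ ⟨x, -, rfl⟩
  exact norm_nonneg _

theorem setOpNorm_nonneg (T : Set (Matrix (Fin d) (Fin d) ℂ)) : 0 ≤ setOpNorm stdNorm T := by
  refine Real.sSup_nonneg ?_
  rintro _ ⟨A, -, rfl⟩
  exact opNorm_nonneg A

theorem jsr_nonneg : 0 ≤ jsr S :=
  Real.iInf_nonneg fun _ => Real.rpow_nonneg (setOpNorm_nonneg _) _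

theorem base_bound (hS : MatBdd S) : ∃ K : ℝ, 0 < K ∧ ∀ A ∈ S, ∀ x, ‖A.mulVec x‖ ≤ K * ‖x‖ := by
  obtain ⟨C, hC⟩ := hS
  refine ⟨d * max C 0 + 1, by positivity, fun A hA x => ?_⟩
  have := entry_bound (fun i j => (hC A hA i j).trans (le_max_left C 0)) (le_max_right C 0) x
  nlinarith [norm_nonneg x]

theorem pow_bound {K : ℝ} (hK : 0 < K) (h : ∀ A ∈ S, ∀ x, ‖A.mulVec x‖ ≤ K * ‖x‖) (n : ℕ) :
    ∀ A ∈ S ^ n, ∀ x, ‖A.mulVec x‖ ≤ K ^ n * ‖x‖ := by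
  induction n with
  | zero =>
    intro A hA x
    simp only [pow_zero, Set.mem_one] at hA
    simp [hA]
  | succ n ih =>
    intro A hA x
    rw [pow_succ] at hA
    obtain ⟨t, ht, s, hs, rfl⟩ := Set.mem_mul.1 hA
    rw [← Matrix.mulVec_mulVec, pow_succ, mul_assoc]
    exact (ih t ht _).trans (mul_le_mul_of_nonneg_left (h s hs x) (by positivity))

theorem growth (hS : MatBdd S) {l : ℝ} (hl : jsr S < l) :
    ∃ C : ℝ, 0 < C ∧ ∀ n, ∀ A ∈ S ^ n, ∀ x, ‖A.mulVec x‖ ≤ C * l ^ n * ‖x‖ := by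
  obtain ⟨K, hK, hb⟩ := base_bound hS
  have hl0 : 0 < l := jsr_nonneg.trans_lt hl
  obtain ⟨m', hm'⟩ := exists_lt_of_ciInf_lt hl
  obtain ⟨m, rfl⟩ : ∃ m, m = m' + 1 := ⟨_, rfl⟩
  have hm : setOpNorm stdNorm (S ^ (m' + 1)) ≤ l ^ (m' + 1) := by
    have h1 := pow_le_pow_left₀ (Real.rpow_nonneg (setOpNorm_nonneg _) _) hm'.le (m' + 1)
    have h2 := Real.rpow_inv_natCast_pow (setOpNorm_nonneg (S ^ (m' + 1))) (Nat.succ_ne_zero m')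
    rw [one_div] at h1
    push_cast at h2
    rwa [h2] at h1
  have hmb : ∀ A ∈ S ^ (m' + 1), ∀ x, ‖A.mulVec x‖ ≤ l ^ (m' + 1) * ‖x‖ := by
    intro A hA x
    refine (le_opNorm A x).trans (mul_le_mul_of_nonneg_right (le_trans ?_ hm) (norm_nonneg _))
    refine le_csSup ⟨K ^ (m' + 1), ?_⟩ (Set.mem_image_of_mem _ hA)
    rintro _ ⟨B, hB, rfl⟩
    exact opNorm_le (by positivity) (pow_bound hK hb _ B hB)
  have hCpos : 0 < ∑ i ∈ Finset.range (m' + 1), (K / l) ^ i :=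
    Finset.sum_pos (fun i _ => by positivity) ⟨0, by simp⟩
  refine ⟨_, hCpos, fun n => ?_⟩
  induction n using Nat.strong_induction_on with
  | _ n ih =>
    intro A hA x
    by_cases hn : n < m' + 1
    · refine (pow_bound hK hb n A hA x).trans (mul_le_mul_of_nonneg_right ?_ (norm_nonneg _))
      have := Finset.single_le_sum (f := fun i => (K / l) ^ i) (fun i _ => by positivity)
        (Finset.mem_range.2 hn)
      calc K ^ n = (K / l) ^ n * l ^ n := by rw [div_pow]; field_simp
        _ ≤ _ := mul_le_mul_of_nonneg_right this (by positivity)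
    · obtain ⟨k, rfl⟩ : ∃ k, n = k + (m' + 1) := ⟨n - (m' + 1), by omega⟩
      rw [pow_add] at hA
      obtain ⟨t, ht, s, hs, rfl⟩ := Set.mem_mul.1 hA
      rw [← Matrix.mulVec_mulVec, pow_add l, ← mul_assoc, mul_assoc _ (l ^ (m' + 1))]
      exact (ih k (by omega) t ht _).trans
        (mul_le_mul_of_nonneg_left (hmb s hs x) (by positivity))

theorem jsr_pow_le {n : ℕ} (hn : n ≠ 0) {c : ℝ} (hc : 0 ≤ c)
    (h : ∀ A ∈ S ^ n, ∀ x, ‖A.mulVec x‖ ≤ c * ‖x‖) : jsr S ^ n ≤ c := by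
  obtain ⟨m, rfl⟩ := Nat.exists_eq_succ_of_ne_zero hn
  have h1 : setOpNorm stdNorm (S ^ (m + 1)) ≤ c := by
    refine Real.sSup_le ?_ hc
    rintro _ ⟨A, hA, rfl⟩
    exact opNorm_le hc (h A hA)
  have h2 : jsr S ≤ setOpNorm stdNorm (S ^ (m + 1)) ^ (1 / (m + 1 : ℝ)) := by
    refine ciInf_le ⟨0, ?_⟩ m
    rintro _ ⟨k, rfl⟩
    exact Real.rpow_nonneg (setOpNorm_nonneg _) _
  have h3 := pow_le_pow_left₀ jsr_nonneg h2 (m + 1)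
  have h4 := Real.rpow_inv_natCast_pow (setOpNorm_nonneg (S ^ (m + 1))) (Nat.succ_ne_zero m)
  push_cast at h4
  rw [one_div, h4] at h3
  exact h3.trans h1

/-- Uniform expansion forces a lower bound on the joint spectral radius. -/
theorem le_jsr [NeZero d] (hS : MatBdd S) {r : ℝ} (hr : 0 < r)
    (h : ∀ x : Fin d → ℂ, ‖x‖ = 1 → ∃ n, n ≠ 0 ∧ ∃ A ∈ S ^ n, r ^ n < ‖A.mulVec x‖) :
    r ≤ jsr S := by
  by_contra! hlt
  obtain ⟨l, hl1, hl2⟩ := exists_between hlt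
  have hl0 : 0 < l := jsr_nonneg.trans_lt hl1
  obtain ⟨C, hC, hg⟩ := growth hS hl1
  have h' : ∀ x : Fin d → ℂ, x ≠ 0 → ∃ n, n ≠ 0 ∧ ∃ A ∈ S ^ n, r ^ n * ‖x‖ < ‖A.mulVec x‖ := by
    intro x hx
    have hpos : 0 < ‖x‖ := norm_pos_iff.2 hx
    obtain ⟨n, hn, A, hA, hlt⟩ := h (((‖x‖⁻¹ : ℝ) : ℂ) • x) (by simp [norm_smul, hpos.ne'])
    refine ⟨n, hn, A, hA, ?_⟩
    have h2 : ‖A.mulVec (((‖x‖⁻¹ : ℝ) : ℂ) • x)‖ = ‖x‖⁻¹ * ‖A.mulVec x‖ := by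
      simp [Matrix.mulVec_smul, norm_smul]
    rw [h2, lt_inv_mul_iff₀ hpos] at hlt
    linarith
  let x0 : Fin d → ℂ := fun _ => 1
  have hx0 : ‖x0‖ = 1 := by simp [x0]
  have key : ∀ k : ℕ, ∃ n, k ≤ n ∧ ∃ A ∈ S ^ n, r ^ n ≤ ‖A.mulVec x0‖ := by
    intro k
    induction k with
    | zero => exact ⟨0, le_rfl, 1, by simp, by simp [hx0]⟩
    | succ k ih =>
      obtain ⟨n, hn, A, hA, hle⟩ := ih
      have hne : A.mulVec x0 ≠ 0 := by
        rw [← norm_pos_iff]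
        exact (pow_pos hr n).trans_le hle
      obtain ⟨m, hm, B, hB, hlt⟩ := h' _ hne
      refine ⟨m + n, by omega, B * A, ?_, ?_⟩
      · rw [pow_add]; exact Set.mul_mem_mul hB hA
      · rw [← Matrix.mulVec_mulVec, pow_add]
        exact (mul_le_mul_of_nonneg_left hle (by positivity)).trans hlt.le
  have htend := tendsto_pow_atTop_atTop_of_one_lt ((one_lt_div hl0).2 hl2)
  obtain ⟨N, hN⟩ := Filter.eventually_atTop.1 (htend.eventually_gt_atTop C)
  obtain ⟨n, hn, A, hA, hle⟩ := key N
  have h1 := hg n A hA x0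
  rw [hx0, mul_one] at h1
  have h2 := hN n hn
  rw [div_pow, lt_div_iff₀ (by positivity)] at h2
  linarith

/-- Expansion at every point forces a strict lower bound, by compactness. -/
theorem lt_jsr [NeZero d] (hS : MatBdd S) {r : ℝ} (hr : 0 ≤ r)
    (h : ∀ x : Fin d → ℂ, x ≠ 0 → ∃ n, n ≠ 0 ∧ ∃ A ∈ S ^ n, r ^ n * ‖x‖ < ‖A.mulVec x‖) :
    r < jsr S := by
  let U : Set.Ioi r → Set (Fin d → ℂ) := fun q =>
    {x | ∃ n, n ≠ 0 ∧ ∃ A ∈ S ^ n, (q : ℝ) ^ n < ‖A.mulVec x‖}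
  have hne : Nonempty (Set.Ioi r) := ⟨⟨r + 1, by simp⟩⟩
  have hU : ∀ q, IsOpen (U q) := by
    intro q
    have : U q = ⋃ n, ⋃ (_ : n ≠ 0), ⋃ A ∈ S ^ n, {x | (q : ℝ) ^ n < ‖A.mulVec x‖} := by
      ext x; simp [U]
    rw [this]
    refine isOpen_iUnion fun n => isOpen_iUnion fun _ => isOpen_biUnion fun A _ => ?_
    exact isOpen_lt continuous_const (by fun_prop)
  have hcov : Metric.sphere (0 : Fin d → ℂ) 1 ⊆ ⋃ q, U q := by
    intro x hx
    have hx1 : ‖x‖ = 1 := by simpa using hx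
    obtain ⟨n, hn, A, hA, hlt⟩ := h x (by rintro rfl; simp at hx1)
    rw [hx1, mul_one] at hlt
    have hc : Tendsto (fun q : ℝ => q ^ n) (nhdsWithin r (Set.Ioi r)) (nhds (r ^ n)) :=
      ((continuous_pow n).tendsto r).mono_left nhdsWithin_le_nhds
    obtain ⟨q, hq, hq'⟩ := ((hc.eventually_lt_const hlt).and self_mem_nhdsWithin).exists
    exact Set.mem_iUnion.2 ⟨⟨q, hq'⟩, n, hn, A, hA, hq⟩
  have hdir : Directed (· ⊆ ·) U := by
    intro a b
    refine ⟨min a b, ?_, ?_⟩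
    all_goals
      rintro x ⟨n, hn, A, hA, hlt⟩
      refine ⟨n, hn, A, hA, lt_of_le_of_lt (pow_le_pow_left₀ ?_ ?_ n) hlt⟩
      · exact hr.trans (min a b).2.le
      · first
        | exact Subtype.coe_le_coe.2 (min_le_left a b)
        | exact Subtype.coe_le_coe.2 (min_le_right a b)
  obtain ⟨q, hq⟩ := (isCompact_sphere (0 : Fin d → ℂ) 1).elim_directed_cover U hU hcov hdir
  refine lt_of_lt_of_le q.2 (le_jsr hS (hr.trans_lt q.2) fun x hx => hq (by simpa using hx))

theorem unif_of_basis (A : Matrix (Fin d) (Fin d) ℂ) {c : ℝ}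
    (h : ∀ i, ‖A.mulVec (Pi.single i 1)‖ ≤ c) (x : Fin d → ℂ) :
    ‖A.mulVec x‖ ≤ (d * c) * ‖x‖ := by
  have hx : A.mulVec x = ∑ i, x i • A.mulVec (Pi.single i 1) := by
    conv_lhs => rw [pi_eq_sum_univ' x]
    rw [Matrix.mulVec_sum]
    simp only [Matrix.mulVec_smul]
  rw [hx]
  calc _ ≤ ∑ i, ‖x i • A.mulVec (Pi.single i 1)‖ := norm_sum_le _ _
    _ ≤ ∑ _i : Fin d, ‖x‖ * c := by
        refine Finset.sum_le_sum fun i _ => ?_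
        rw [norm_smul]
        exact mul_le_mul (norm_le_pi_norm x i) (h i) (norm_nonneg _) (norm_nonneg _)
    _ = _ := by simp; ring

/-- Product boundedness of the normalised semigroup. -/
theorem prod_bdd [NeZero d] (hS : MatBdd S) (hirr : IsIrred S) :
    ∃ C : ℝ, 0 < C ∧ ∀ n, ∀ A ∈ S ^ n, ∀ x, ‖A.mulVec x‖ ≤ C * jsr S ^ n * ‖x‖ := by
  let W : Submodule ℂ (Fin d → ℂ) :=
    { carrier := {x | ∃ C : ℝ, ∀ n, ∀ A ∈ S ^ n, ‖A.mulVec x‖ ≤ C * jsr S ^ n}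
      zero_mem' := ⟨0, fun n A _ => by simp⟩
      add_mem' := by
        rintro x y ⟨C, hC⟩ ⟨D, hD⟩
        refine ⟨C + D, fun n A hA => ?_⟩
        rw [Matrix.mulVec_add, add_mul]
        exact (norm_add_le _ _).trans (add_le_add (hC n A hA) (hD n A hA))
      smul_mem' := by
        rintro a x ⟨C, hC⟩
        refine ⟨‖a‖ * C, fun n A hA => ?_⟩
        rw [Matrix.mulVec_smul, norm_smul, mul_assoc]
        exact mul_le_mul_of_nonneg_left (hC n A hA) (norm_nonneg _) }
  have hW : ∀ A ∈ S, ∀ x ∈ W, A.mulVec x ∈ W := by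
    rintro A hA x ⟨C, hC⟩
    refine ⟨C * jsr S, fun n B hB => ?_⟩
    have := hC (n + 1) (B * A) (by rw [pow_succ]; exact Set.mul_mem_mul hB hA)
    rw [Matrix.mulVec_mulVec]
    refine this.trans_eq (by ring)
  rcases hirr W hW with h | h
  · exfalso
    refine lt_irrefl _ (lt_jsr hS jsr_nonneg fun x hx => ?_)
    have hxW : x ∉ W := by rw [h]; simpa using hx
    by_contra! hcon
    refine hxW ⟨‖x‖, fun n A hA => ?_⟩
    by_cases hn : n = 0
    · subst hn
      simp only [pow_zero, Set.mem_one] at hA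
      simp [hA]
    · rw [mul_comm]; exact hcon n hn A hA
  · have hall : ∀ x, x ∈ W := fun x => by rw [h]; trivial
    choose C hC using fun i : Fin d => hall (Pi.single i 1)
    let D : ℝ := ∑ i, |C i|
    have hD : 0 ≤ D := by positivity
    refine ⟨d * D + 1, by positivity, fun n A hA x => ?_⟩
    have hp : 0 ≤ jsr S ^ n := pow_nonneg jsr_nonneg n
    refine (unif_of_basis A (c := D * jsr S ^ n) (fun i => ?_) x).trans ?_
    · refine (hC i n A hA).trans (mul_le_mul_of_nonneg_right ?_ hp)
      exact (le_abs_self _).trans (Finset.single_le_sum (f := fun i => |C i|)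
        (fun _ _ => abs_nonneg _) (Finset.mem_univ i))
    · refine mul_le_mul_of_nonneg_right ?_ (norm_nonneg _)
      nlinarith

/-- `h n x = ‖Sⁿ x‖ / ρⁿ`. -/
noncomputable def hh (S : Set (Matrix (Fin d) (Fin d) ℂ)) (n : ℕ) (x : Fin d → ℂ) : ℝ :=
  sSup ((fun s : Matrix (Fin d) (Fin d) ℂ => ‖s.mulVec x‖) '' (S ^ n)) / jsr S ^ n

/-- The Barabanov norm. -/
noncomputable def vv (S : Set (Matrix (Fin d) (Fin d) ℂ)) (x : Fin d → ℂ) : ℝ :=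
  limsup (fun n => hh S n x) atTop

theorem hh_nonneg (n : ℕ) (x : Fin d → ℂ) : 0 ≤ hh S n x := by
  refine div_nonneg (Real.sSup_nonneg ?_) (pow_nonneg jsr_nonneg n)
  rintro _ ⟨A, -, rfl⟩
  exact norm_nonneg _

theorem hh_le (hρ : 0 < jsr S) {n : ℕ} {x : Fin d → ℂ} {a : ℝ} (ha : 0 ≤ a)
    (h : ∀ A ∈ S ^ n, ‖A.mulVec x‖ ≤ a * jsr S ^ n) : hh S n x ≤ a := by
  rw [hh, div_le_iff₀ (pow_pos hρ n)]
  refine Real.sSup_le ?_ (by positivity)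
  rintro _ ⟨A, hA, rfl⟩
  exact h A hA


theorem le_hh {C : ℝ} (hρ : 0 < jsr S)
    (hb : ∀ n, ∀ A ∈ S ^ n, ∀ x, ‖A.mulVec x‖ ≤ C * jsr S ^ n * ‖x‖)
    {n : ℕ} {A : Matrix (Fin d) (Fin d) ℂ} (hA : A ∈ S ^ n) (x : Fin d → ℂ) :
    ‖A.mulVec x‖ ≤ hh S n x * jsr S ^ n := by
  rw [hh, div_mul_cancel₀ _ (pow_pos hρ n).ne']
  refine le_csSup ⟨C * jsr S ^ n * ‖x‖, ?_⟩ ⟨A, hA, rfl⟩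
  rintro _ ⟨B, hB, rfl⟩
  exact hb n B hB x

theorem hh_bound {C : ℝ} (hρ : 0 < jsr S) (hC : 0 < C)
    (hb : ∀ n, ∀ A ∈ S ^ n, ∀ x, ‖A.mulVec x‖ ≤ C * jsr S ^ n * ‖x‖)
    (n : ℕ) (x : Fin d → ℂ) : hh S n x ≤ C * ‖x‖ :=
  hh_le hρ (by positivity) fun A hA => (hb n A hA x).trans_eq (by ring)

theorem hh_add {C : ℝ} (hρ : 0 < jsr S)
    (hb : ∀ n, ∀ A ∈ S ^ n, ∀ x, ‖A.mulVec x‖ ≤ C * jsr S ^ n * ‖x‖)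
    (n : ℕ) (x y : Fin d → ℂ) : hh S n (x + y) ≤ hh S n x + hh S n y := by
  refine hh_le hρ (add_nonneg (hh_nonneg _ _) (hh_nonneg _ _)) fun A hA => ?_
  rw [Matrix.mulVec_add, add_mul]
  exact (norm_add_le _ _).trans (add_le_add (le_hh hρ hb hA x) (le_hh hρ hb hA y))

theorem hh_smul {C : ℝ} (hρ : 0 < jsr S)
    (hb : ∀ n, ∀ A ∈ S ^ n, ∀ x, ‖A.mulVec x‖ ≤ C * jsr S ^ n * ‖x‖)
    (n : ℕ) (a : ℂ) (x : Fin d → ℂ) : hh S n (a • x) ≤ ‖a‖ * hh S n x := by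
  refine hh_le hρ (mul_nonneg (norm_nonneg _) (hh_nonneg _ _)) fun A hA => ?_
  rw [Matrix.mulVec_smul, norm_smul, mul_assoc]
  exact mul_le_mul_of_nonneg_left (le_hh hρ hb hA x) (norm_nonneg _)

theorem hh_step {C : ℝ} (hρ : 0 < jsr S)
    (hb : ∀ n, ∀ A ∈ S ^ n, ∀ x, ‖A.mulVec x‖ ≤ C * jsr S ^ n * ‖x‖)
    (n : ℕ) {A : Matrix (Fin d) (Fin d) ℂ} (hA : A ∈ S) (x : Fin d → ℂ) :
    hh S n (A.mulVec x) ≤ jsr S * hh S (n + 1) x := by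
  refine hh_le hρ (mul_nonneg hρ.le (hh_nonneg _ _)) fun B hB => ?_
  rw [Matrix.mulVec_mulVec]
  have := le_hh hρ hb (n := n + 1) (A := B * A) (by rw [pow_succ]; exact Set.mul_mem_mul hB hA) x
  exact this.trans_eq (by ring)

theorem hh_succ_le {C : ℝ} (hρ : 0 < jsr S)
    (hb : ∀ n, ∀ A ∈ S ^ n, ∀ x, ‖A.mulVec x‖ ≤ C * jsr S ^ n * ‖x‖)
    (n : ℕ) (x : Fin d → ℂ) {a : ℝ} (ha : 0 ≤ a)
    (h : ∀ A ∈ S, hh S n (A.mulVec x) ≤ a) : hh S (n + 1) x ≤ a / jsr S := by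
  refine hh_le hρ (by positivity) fun B hB => ?_
  rw [pow_succ] at hB
  obtain ⟨t, ht, s, hs, rfl⟩ := Set.mem_mul.1 hB
  rw [← Matrix.mulVec_mulVec]
  refine (le_hh hρ hb ht _).trans ((mul_le_mul_of_nonneg_right (h s hs)
    (pow_nonneg hρ.le n)).trans_eq ?_)
  rw [pow_succ]; field_simp

theorem hh_cobdd (x : Fin d → ℂ) : IsCoboundedUnder (· ≤ ·) atTop (fun n => hh S n x) :=
  IsBoundedUnder.isCoboundedUnder_le ⟨0, by simp [hh_nonneg]⟩

theorem vv_le {x : Fin d → ℂ} {a : ℝ} (h : ∀ᶠ n in atTop, hh S n x ≤ a) : vv S x ≤ a :=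
  limsup_le_of_le (hh_cobdd x) h

theorem ev_lt {C : ℝ} (hρ : 0 < jsr S) (hC : 0 < C)
    (hb : ∀ n, ∀ A ∈ S ^ n, ∀ x, ‖A.mulVec x‖ ≤ C * jsr S ^ n * ‖x‖)
    {x : Fin d → ℂ} {a : ℝ} (h : vv S x < a) : ∀ᶠ n in atTop, hh S n x < a :=
  eventually_lt_of_limsup_lt h ⟨C * ‖x‖, by simp [hh_bound hρ hC hb]⟩

theorem vv_nonneg {C : ℝ} (hρ : 0 < jsr S) (hC : 0 < C)
    (hb : ∀ n, ∀ A ∈ S ^ n, ∀ x, ‖A.mulVec x‖ ≤ C * jsr S ^ n * ‖x‖)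
    (x : Fin d → ℂ) : 0 ≤ vv S x := by
  by_contra! h
  obtain ⟨n, hn⟩ := (ev_lt hρ hC hb h).exists
  exact absurd hn (not_lt.2 (hh_nonneg n x))

theorem vv_add {C : ℝ} (hρ : 0 < jsr S) (hC : 0 < C)
    (hb : ∀ n, ∀ A ∈ S ^ n, ∀ x, ‖A.mulVec x‖ ≤ C * jsr S ^ n * ‖x‖)
    (x y : Fin d → ℂ) : vv S (x + y) ≤ vv S x + vv S y := by
  refine le_of_forall_pos_le_add fun ε hε => vv_le ?_
  filter_upwards [ev_lt hρ hC hb (lt_add_of_pos_right (vv S x) (half_pos hε)),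
    ev_lt hρ hC hb (lt_add_of_pos_right (vv S y) (half_pos hε))] with n h1 h2
  have := hh_add hρ hb n x y
  linarith

theorem vv_smul_le {C : ℝ} (hρ : 0 < jsr S) (hC : 0 < C)
    (hb : ∀ n, ∀ A ∈ S ^ n, ∀ x, ‖A.mulVec x‖ ≤ C * jsr S ^ n * ‖x‖)
    (a : ℂ) (x : Fin d → ℂ) : vv S (a • x) ≤ ‖a‖ * vv S x := by
  have key : ∀ ε > 0, vv S (a • x) ≤ ‖a‖ * (vv S x + ε) := by
    intro ε hε
    refine vv_le ?_
    filter_upwards [ev_lt hρ hC hb (lt_add_of_pos_right (vv S x) hε)] with n h1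
    exact (hh_smul hρ hb n a x).trans (mul_le_mul_of_nonneg_left h1.le (norm_nonneg _))
  refine le_of_forall_pos_le_add fun ε hε => ?_
  have h1 := key (ε / (‖a‖ + 1)) (by positivity)
  have h2 : ‖a‖ * (ε / (‖a‖ + 1)) ≤ ε := by
    rw [mul_div_assoc', div_le_iff₀ (by positivity)]
    nlinarith [norm_nonneg a]
  linarith

theorem vv_smul {C : ℝ} (hρ : 0 < jsr S) (hC : 0 < C)
    (hb : ∀ n, ∀ A ∈ S ^ n, ∀ x, ‖A.mulVec x‖ ≤ C * jsr S ^ n * ‖x‖)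
    (a : ℂ) (x : Fin d → ℂ) : vv S (a • x) = ‖a‖ * vv S x := by
  refine le_antisymm (vv_smul_le hρ hC hb a x) ?_
  by_cases ha : a = 0
  · simpa [ha] using vv_nonneg hρ hC hb 0
  · have hpos : 0 < ‖a‖ := norm_pos_iff.2 ha
    have := vv_smul_le hρ hC hb a⁻¹ (a • x)
    rw [smul_smul, inv_mul_cancel₀ ha, one_smul, norm_inv, le_inv_mul_iff₀ hpos] at this
    exact this

theorem vv_step {C : ℝ} (hρ : 0 < jsr S) (hC : 0 < C)
    (hb : ∀ n, ∀ A ∈ S ^ n, ∀ x, ‖A.mulVec x‖ ≤ C * jsr S ^ n * ‖x‖)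
    {A : Matrix (Fin d) (Fin d) ℂ} (hA : A ∈ S) (x : Fin d → ℂ) :
    vv S (A.mulVec x) ≤ jsr S * vv S x := by
  refine le_of_forall_pos_le_add fun ε hε => vv_le ?_
  have h1 := ev_lt hρ hC hb (lt_add_of_pos_right (vv S x) (div_pos hε hρ))
  filter_upwards [(tendsto_add_atTop_nat 1).eventually h1] with n hn
  refine (hh_step hρ hb n hA x).trans ((mul_le_mul_of_nonneg_left hn.le hρ.le).trans_eq ?_)
  field_simp

theorem vv_eq_zero {C : ℝ} (hρ : 0 < jsr S) (hC : 0 < C)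
    (hb : ∀ n, ∀ A ∈ S ^ n, ∀ x, ‖A.mulVec x‖ ≤ C * jsr S ^ n * ‖x‖)
    (hirr : IsIrred S) (x : Fin d → ℂ) : vv S x = 0 ↔ x = 0 := by
  have h0 : vv S 0 = 0 := by simpa using vv_smul hρ hC hb 0 0
  refine ⟨fun hx => ?_, fun hx => by rw [hx, h0]⟩
  let W : Submodule ℂ (Fin d → ℂ) :=
    { carrier := {x | vv S x = 0}
      zero_mem' := h0
      add_mem' := by
        intro x y hx hy
        have h1 := vv_add hρ hC hb x y
        simp only [Set.mem_ofPred_eq] at hx hy ⊢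
        rw [hx, hy, add_zero] at h1
        exact le_antisymm h1 (vv_nonneg hρ hC hb _)
      smul_mem' := by
        intro a x hx
        simp only [Set.mem_ofPred_eq] at hx ⊢
        rw [vv_smul hρ hC hb, hx, mul_zero] }
  have hW : ∀ A ∈ S, ∀ x ∈ W, A.mulVec x ∈ W := by
    intro A hA x hx
    have hx' : vv S x = 0 := hx
    have h1 := vv_step hρ hC hb hA x
    rw [hx', mul_zero] at h1
    exact le_antisymm h1 (vv_nonneg hρ hC hb _)
  rcases hirr W hW with h | h
  · have : x ∈ W := hx
    rw [h] at this
    simpa using this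
  · exfalso
    have hall : ∀ x, vv S x = 0 := fun x => by
      have : x ∈ W := by rw [h]; trivial
      exact this
    have hev : ∀ᶠ n in atTop, ∀ i : Fin d, hh S n (Pi.single i 1) < 1 / (2 * (d + 1)) := by
      rw [eventually_all]
      intro i
      exact ev_lt hρ hC hb (by rw [hall]; positivity)
    obtain ⟨n, hn, hn0⟩ := (hev.and (eventually_ne_atTop 0)).exists
    have hp := pow_pos hρ n
    have := jsr_pow_le (S := S) hn0 (c := d * (1 / (2 * (d + 1)) * jsr S ^ n)) (by positivity)
      fun A hA x => unif_of_basis A (fun i => (le_hh hρ hb hA _).trans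
        (mul_le_mul_of_nonneg_right (hn i).le hp.le)) x
    have h3 : (d : ℝ) * (1 / (2 * (d + 1))) < 1 := by
      rw [mul_one_div, div_lt_one (by positivity)]
      have : (0 : ℝ) ≤ d := by positivity
      linarith
    nlinarith

theorem vv_le_of {C : ℝ} (hρ : 0 < jsr S) (hC : 0 < C)
    (hb : ∀ n, ∀ A ∈ S ^ n, ∀ x, ‖A.mulVec x‖ ≤ C * jsr S ^ n * ‖x‖)
    (x : Fin d → ℂ) {M : ℝ} (hM : 0 ≤ M)
    (h : ∀ A ∈ S, vv S (A.mulVec x) ≤ M) : jsr S * vv S x ≤ M := by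
  have key : ∀ ε > 0, jsr S * vv S x ≤ M + (1 + C) * ε := by
    intro ε hε
    let T : Set (Fin d → ℂ) := (fun s : Matrix (Fin d) (Fin d) ℂ => s.mulVec x) '' S
    have hTb : Bornology.IsBounded T := by
      rw [isBounded_iff_forall_norm_le]
      refine ⟨C * jsr S ^ 1 * ‖x‖, ?_⟩
      rintro _ ⟨A, hA, rfl⟩
      exact hb 1 A (by simpa using hA) x
    have hT : TotallyBounded T :=
      (hTb.isCompact_closure.totallyBounded).subset subset_closure
    obtain ⟨t, htT, htf, hcov⟩ := Metric.finite_approx_of_totallyBounded hT ε hε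
    have hev : ∀ᶠ n in atTop, ∀ y ∈ t, hh S n y < M + ε := by
      rw [eventually_all_finite htf]
      intro y hy
      obtain ⟨A, hA, rfl⟩ := htT hy
      exact ev_lt hρ hC hb ((h A hA).trans_lt (by linarith))
    have hev2 : ∀ᶠ n in atTop, hh S (n + 1) x ≤ (M + (1 + C) * ε) / jsr S := by
      filter_upwards [hev] with n hn
      refine hh_succ_le hρ hb n x (by positivity) fun A hA => ?_
      obtain ⟨y, hy, hd⟩ := Set.mem_iUnion₂.1 (hcov (Set.mem_image_of_mem _ hA))
      rw [Metric.mem_ball, dist_eq_norm] at hd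
      have h1 := hh_add hρ hb n y (A.mulVec x - y)
      rw [add_sub_cancel] at h1
      have h2 := hh_bound hρ hC hb n (A.mulVec x - y)
      have h3 := hn y hy
      have h4 := mul_le_mul_of_nonneg_left hd.le hC.le
      linarith
    have h5 : vv S x ≤ (M + (1 + C) * ε) / jsr S :=
      vv_le (by
        obtain ⟨N, hN⟩ := eventually_atTop.1 hev2
        refine eventually_atTop.2 ⟨N + 1, fun n hn => ?_⟩
        obtain ⟨k, rfl⟩ : ∃ k, n = k + 1 := ⟨n - 1, by omega⟩
        exact hN k (by omega))
    rw [le_div_iff₀ hρ] at h5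
    linarith
  refine le_of_forall_pos_le_add fun ε hε => ?_
  have := key (ε / (1 + C)) (by positivity)
  rwa [mul_div_cancel₀ _ (by positivity)] at this

end BarabanovAux

open BarabanovAux

/-- Barabanov norm: if `S` is bounded and irreducible, there is a norm `v`
on `ℂ^d` with `sup_{s ∈ S} v(sx) = ρ(S)·v(x)` for all `x`. -/
theorem stmt_6 {d : ℕ} (S : Set (Matrix (Fin d) (Fin d) ℂ)) (hS : MatBdd S)
    (hirr : IsIrred S) :
    ∃ v : (Fin d → ℂ) → ℝ, IsCNorm v ∧
      ∀ x : Fin d → ℂ, sSup ((fun s : Matrix (Fin d) (Fin d) ℂ => v (s.mulVec x)) '' S)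
        = jsr S * v x := by
  rcases Nat.eq_zero_or_pos d with hd | hd
  · subst hd
    refine ⟨fun _ => 0, ⟨fun _ => le_rfl, fun x => by simp [Subsingleton.elim x 0],
      by simp, by simp⟩, fun x => ?_⟩
    rw [mul_zero]
    refine le_antisymm (Real.sSup_le ?_ le_rfl) (Real.sSup_nonneg ?_)
    · rintro _ ⟨A, -, rfl⟩; exact le_rfl
    · rintro _ ⟨A, -, rfl⟩; exact le_rfl
  have : NeZero d := ⟨hd.ne'⟩
  rcases (jsr_nonneg (S := S)).eq_or_lt with h0 | hρ
  · let W : Submodule ℂ (Fin d → ℂ) :=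
      { carrier := {x | ∀ A ∈ S, A.mulVec x = 0}
        zero_mem' := fun A _ => by simp
        add_mem' := by
          intro x y hx hy A hA
          rw [Matrix.mulVec_add, hx A hA, hy A hA, add_zero]
        smul_mem' := by
          intro a x hx A hA
          rw [Matrix.mulVec_smul, hx A hA, smul_zero] }
    have hW : ∀ A ∈ S, ∀ x ∈ W, A.mulVec x ∈ W := by
      intro A hA x hx B hB
      rw [hx A hA, Matrix.mulVec_zero]
    rcases hirr W hW with h | h
    · exfalso
      refine absurd (lt_jsr hS le_rfl fun x hx => ?_) (by rw [← h0]; exact lt_irrefl _)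
      have hxW : x ∉ W := by rw [h]; simpa using hx
      by_contra! hcon
      refine hxW fun A hA => ?_
      have := hcon 1 one_ne_zero A (by simpa using hA)
      simpa using this
    · have hall : ∀ x, ∀ A ∈ S, A.mulVec x = 0 := fun x => by
        have : x ∈ W := by rw [h]; trivial
        exact this
      refine ⟨fun x => ‖x‖, ⟨norm_nonneg, fun x => norm_eq_zero, norm_smul, norm_add_le⟩,
        fun x => ?_⟩
      rw [← h0, zero_mul]
      refine le_antisymm (Real.sSup_le ?_ le_rfl) (Real.sSup_nonneg ?_)
      · rintro _ ⟨A, hA, rfl⟩; simp [hall x A hA]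
      · rintro _ ⟨A, -, rfl⟩; exact norm_nonneg _
  · obtain ⟨C, hC, hb⟩ := prod_bdd hS hirr
    refine ⟨vv S, ⟨vv_nonneg hρ hC hb, vv_eq_zero hρ hC hb hirr, vv_smul hρ hC hb,
      vv_add hρ hC hb⟩, fun x => ?_⟩
    refine le_antisymm (Real.sSup_le ?_ (mul_nonneg hρ.le (vv_nonneg hρ hC hb x))) ?_
    · rintro _ ⟨A, hA, rfl⟩
      exact vv_step hρ hC hb hA x
    · refine vv_le_of hρ hC hb x (Real.sSup_nonneg ?_) fun A hA => ?_
      · rintro _ ⟨A, -, rfl⟩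
        exact vv_nonneg hρ hC hb _
      · refine le_csSup ⟨jsr S * vv S x, ?_⟩ ⟨A, hA, rfl⟩
        rintro _ ⟨B, hB, rfl⟩
        exact vv_step hρ hC hb hB x
end

section
/- Let S ⊂ M_d(ℂ) be bounded irreducible with ρ(S) = 1, and let T_∞ := ⋂_{n≥1} closure(Sⁿ·T) be the attractor semigroup, where T = ⋃_{n≥1} Sⁿ. Then T_∞ is irreducible and ρ(T_∞) = 1. -/
open scoped Pointwise
open Filter

/-- The semigroup `T = ⋃_{n ≥ 1} Sⁿ` generated by `S`. -/
def genSemigroup {d : ℕ} (S : Set (Matrix (Fin d) (Fin d) ℂ)) : Set (Matrix (Fin d) (Fin d) ℂ) :=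
  ⋃ n : ℕ, S ^ (n + 1)

/-- The attractor semigroup `T_∞ = ⋂_{n ≥ 1} closure(Sⁿ·T)`. -/
def attractor {d : ℕ} (S : Set (Matrix (Fin d) (Fin d) ℂ)) : Set (Matrix (Fin d) (Fin d) ℂ) :=
  ⋂ n : ℕ, closure (S ^ (n + 1) * genSemigroup S)

section Helpers
open scoped Matrix.Norms.Operator

lemma aux_opNorm_eq {d : ℕ} (A : Matrix (Fin d) (Fin d) ℂ) : opNorm stdNorm A = ‖A‖ := by
  rw [Matrix.linfty_opNorm_eq_opNorm, ← ContinuousLinearMap.sSup_unitClosedBall_eq_norm]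
  unfold opNorm stdNorm
  congr 1
  ext c
  simp only [Set.mem_ofPred_eq, Set.mem_image, Metric.mem_closedBall, dist_zero_right]
  constructor
  · rintro ⟨x, hx, rfl⟩
    exact ⟨x, hx, rfl⟩
  · rintro ⟨x, hx, rfl⟩
    exact ⟨x, hx, rfl⟩

lemma aux_setOpNorm_eq {d : ℕ} (S : Set (Matrix (Fin d) (Fin d) ℂ)) :
    setOpNorm stdNorm S = sSup (norm '' S) := by
  unfold setOpNorm
  congr 1
  exact Set.image_congr fun A _ => aux_opNorm_eq A

lemma aux_entry_bound {d : ℕ} (A : Matrix (Fin d) (Fin d) ℂ) (C : Fin d → ℝ)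
    (h : ∀ i j, ‖A i j‖ ≤ C j) (hC : ∀ j, 0 ≤ C j) : ‖A‖ ≤ ∑ j, C j := by
  rw [Matrix.linfty_opNorm_def]
  have h0 : 0 ≤ ∑ j, C j := Finset.sum_nonneg fun j _ => hC j
  have : (Finset.univ.sup fun i => ∑ j, ‖A i j‖₊) ≤ (⟨∑ j, C j, h0⟩ : NNReal) := by
    apply Finset.sup_le
    intro i _
    have h2 : ((∑ j, ‖A i j‖₊ : NNReal) : ℝ) ≤ ∑ j, C j := by
      push_cast
      exact Finset.sum_le_sum fun j _ => h i j
    exact h2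
  exact_mod_cast this

lemma aux_bdd {d : ℕ} (S : Set (Matrix (Fin d) (Fin d) ℂ)) (hS : MatBdd S) :
    ∃ M : ℝ, 1 ≤ M ∧ ∀ A ∈ S, ‖A‖ ≤ M := by
  obtain ⟨C, hC⟩ := hS
  refine ⟨max 1 (∑ _j : Fin d, max 0 C), le_max_left _ _, fun A hA => ?_⟩
  refine le_trans (aux_entry_bound A (fun _ => max 0 C) ?_ ?_) (le_max_right _ _)
  · intro i j
    exact (hC A hA i j).trans (le_max_right _ _)
  · intro j
    exact le_max_left _ _

lemma aux_norm_one_le {d : ℕ} : ‖(1 : Matrix (Fin d) (Fin d) ℂ)‖ ≤ 1 := by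
  rw [← Matrix.diagonal_one, Matrix.linfty_opNorm_diagonal]
  exact (pi_norm_le_iff_of_nonneg zero_le_one).2 fun i => by simp

lemma aux_pow_bound {d : ℕ} {S : Set (Matrix (Fin d) (Fin d) ℂ)} {M : ℝ} (hM : 1 ≤ M)
    (h : ∀ A ∈ S, ‖A‖ ≤ M) (n : ℕ) : ∀ A ∈ S ^ n, ‖A‖ ≤ M ^ n := by
  induction n with
  | zero =>
    intro A hA
    rw [pow_zero, Set.mem_one] at hA
    subst hA
    simpa using aux_norm_one_le
  | succ n ih =>
    intro A hA
    rw [pow_succ] at hA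
    obtain ⟨B, hB, D, hD, rfl⟩ := Set.mem_mul.1 hA
    rw [pow_succ]
    exact (norm_mul_le _ _).trans
      (mul_le_mul (ih B hB) (h D hD) (norm_nonneg _) (by positivity))

lemma aux_growth {d : ℕ} {S : Set (Matrix (Fin d) (Fin d) ℂ)} (hS : MatBdd S)
    (hρ : jsr S = 1) {r : ℝ} (hr : 1 < r) :
    ∃ C : ℝ, 0 < C ∧ ∀ m, ∀ A ∈ S ^ m, ‖A‖ ≤ C * r ^ m := by
  obtain ⟨M, hM, hSM⟩ := aux_bdd S hS
  have hlt : jsr S < r := by rw [hρ]; exact hr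
  obtain ⟨n, hn⟩ := exists_lt_of_ciInf_lt hlt
  have hb : ∀ A ∈ S ^ (n + 1), ‖A‖ ≤ r ^ (n + 1) := by
    intro A hA
    rw [aux_setOpNorm_eq] at hn
    have h1 : ‖A‖ ≤ sSup (norm '' (S ^ (n + 1))) := by
      apply le_csSup
      · refine ⟨M ^ (n + 1), ?_⟩
        rintro _ ⟨B, hB, rfl⟩
        exact aux_pow_bound hM hSM _ B hB
      · exact ⟨A, hA, rfl⟩
    refine h1.trans ?_
    have h0 : 0 ≤ sSup (norm '' (S ^ (n + 1))) := (norm_nonneg A).trans h1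
    have h2 := pow_le_pow_left₀ (Real.rpow_nonneg h0 _) hn.le (n + 1)
    have h3 : (sSup (norm '' (S ^ (n + 1))) ^ (1 / ((n : ℝ) + 1))) ^ (n + 1)
        = sSup (norm '' (S ^ (n + 1))) := by
      rw [← Real.rpow_natCast, ← Real.rpow_mul h0]
      push_cast
      rw [one_div, inv_mul_cancel₀ (by positivity), Real.rpow_one]
    rwa [h3] at h2
  refine ⟨M ^ (n + 1), by positivity, ?_⟩
  intro m
  induction m using Nat.strong_induction_on with
  | _ m ih =>
    intro A hA
    by_cases hm : m < n + 1
    · have h1 := aux_pow_bound hM hSM m A hA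
      have h2 : M ^ m ≤ M ^ (n + 1) := pow_le_pow_right₀ hM hm.le
      have h3 : (1 : ℝ) ≤ r ^ m := one_le_pow₀ hr.le
      have h4 : 0 < M ^ (n + 1) := by positivity
      nlinarith
    · obtain ⟨k, rfl⟩ := Nat.exists_eq_add_of_le (not_lt.1 hm)
      rw [pow_add] at hA
      obtain ⟨B, hB, D, hD, rfl⟩ := Set.mem_mul.1 hA
      have h1 := ih k (by omega) D hD
      have h2 := hb B hB
      calc ‖B * D‖ ≤ ‖B‖ * ‖D‖ := norm_mul_le _ _
        _ ≤ r ^ (n + 1) * (M ^ (n + 1) * r ^ k) :=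
            mul_le_mul h2 h1 (norm_nonneg _) (by positivity)
        _ = _ := by ring

/-- The product semigroup is bounded. -/
lemma aux_semigroup_bdd {d : ℕ} {S : Set (Matrix (Fin d) (Fin d) ℂ)} (hS : MatBdd S)
    (hirr : IsIrred S) (hρ : jsr S = 1) :
    ∃ C : ℝ, 1 ≤ C ∧ ∀ m, ∀ A ∈ S ^ m, ‖A‖ ≤ C := by
  let W : Submodule ℂ (Fin d → ℂ) :=
    { carrier := {x | ∃ C : ℝ, ∀ m, ∀ A ∈ S ^ m, ‖A.mulVec x‖ ≤ C}
      zero_mem' := ⟨0, fun m A _ => by simp⟩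
      add_mem' := by
        rintro x y ⟨C, hC⟩ ⟨D, hD⟩
        refine ⟨C + D, fun m A hA => ?_⟩
        rw [Matrix.mulVec_add]
        exact (norm_add_le _ _).trans (add_le_add (hC m A hA) (hD m A hA))
      smul_mem' := by
        rintro a x ⟨C, hC⟩
        refine ⟨‖a‖ * C, fun m A hA => ?_⟩
        rw [Matrix.mulVec_smul, norm_smul]
        exact mul_le_mul_of_nonneg_left (hC m A hA) (norm_nonneg _) }
  have hWmem : ∀ x, x ∈ W ↔ ∃ C : ℝ, ∀ m, ∀ A ∈ S ^ m, ‖A.mulVec x‖ ≤ C := fun x => Iff.rfl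
  have hWinv : ∀ A ∈ S, ∀ x ∈ W, A.mulVec x ∈ W := by
    rintro A hA x ⟨C, hC⟩
    refine ⟨C, fun m B hB => ?_⟩
    rw [Matrix.mulVec_mulVec]
    apply hC (m + 1)
    rw [pow_succ]
    exact Set.mul_mem_mul hB hA
  by_cases htop : W = ⊤
  · have hx : ∀ x, x ∈ W := fun x => by rw [htop]; trivial
    choose c hc using fun j : Fin d => (hWmem _).1 (hx (Pi.single j 1))
    refine ⟨max 1 (∑ j, |c j|), le_max_left _ _, fun m A hA => ?_⟩
    refine le_trans (aux_entry_bound A (fun j => |c j|) ?_ (fun j => abs_nonneg _))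
      (le_max_right _ _)
    intro i j
    have h1 := hc j m A hA
    have h2 := norm_le_pi_norm (A.mulVec (Pi.single j 1)) i
    rw [Matrix.mulVec_single_one] at h2 h1
    exact h2.trans (h1.trans (le_abs_self _))
  · exfalso
    have hbot : W = ⊥ := (hirr W hWinv).resolve_right htop
    have hex : ∃ x : Fin d → ℂ, x ≠ 0 := by
      by_contra hcon
      push Not at hcon
      apply htop
      rw [eq_top_iff]
      intro x _
      rw [hcon x]
      exact W.zero_mem
    have hunb : ∀ x : Fin d → ℂ, x ≠ 0 → ∃ m, ∃ A ∈ S ^ m, 2 < ‖A.mulVec x‖ := by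
      intro x hx
      by_contra hcon
      push Not at hcon
      apply hx
      have : x ∈ W := ⟨2, hcon⟩
      rwa [hbot, Submodule.mem_bot] at this
    obtain ⟨t, ht⟩ := (isCompact_sphere (0 : Fin d → ℂ) 1).elim_finite_subcover
      (fun m : ℕ => {x : Fin d → ℂ | ∃ A ∈ S ^ m, 2 < ‖A.mulVec x‖})
      (by
        intro m
        have : {x : Fin d → ℂ | ∃ A ∈ S ^ m, 2 < ‖A.mulVec x‖}
            = ⋃ A ∈ S ^ m, {x : Fin d → ℂ | 2 < ‖A.mulVec x‖} := by
          ext x; simp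
        rw [this]
        refine isOpen_biUnion fun A _ => isOpen_lt continuous_const ?_
        exact (Continuous.matrix_mulVec continuous_const continuous_id).norm)
      (by
        intro x hx
        have hx0 : x ≠ 0 := by
          rintro rfl
          simp at hx
        obtain ⟨m, A, hA, h⟩ := hunb x hx0
        exact Set.mem_iUnion.2 ⟨m, A, hA, h⟩)
    obtain ⟨N, hN⟩ : ∃ N : ℕ, ∀ m ∈ t, m ≤ N := ⟨t.sup id, fun m hm => Finset.le_sup (f := id) hm⟩
    have hstep : ∀ x : Fin d → ℂ, x ≠ 0 → ∃ m ≤ N, ∃ A ∈ S ^ m, 2 * ‖x‖ ≤ ‖A.mulVec x‖ := by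
      intro x hx
      have hnx : 0 < ‖x‖ := norm_pos_iff.2 hx
      have hu : ((‖x‖ : ℂ)⁻¹ • x) ∈ Metric.sphere (0 : Fin d → ℂ) 1 := by
        simp [norm_smul, hnx.ne']
      have := ht hu
      simp only [Set.mem_iUnion] at this
      obtain ⟨m, hm, A, hA, h⟩ := this
      refine ⟨m, hN m hm, A, hA, ?_⟩
      rw [Matrix.mulVec_smul, norm_smul, norm_inv, Complex.norm_real, norm_norm] at h
      rw [inv_mul_eq_div, lt_div_iff₀ hnx] at h
      exact h.le
    obtain ⟨x, hx⟩ := hex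
    have hnx : 0 < ‖x‖ := norm_pos_iff.2 hx
    have hiter : ∀ k : ℕ, ∃ m ≤ N * k, ∃ A ∈ S ^ m, 2 ^ k * ‖x‖ ≤ ‖A.mulVec x‖ := by
      intro k
      induction k with
      | zero => exact ⟨0, by simp, 1, by simp, by simp⟩
      | succ k ih =>
        obtain ⟨m, hm, A, hA, h⟩ := ih
        have hne : A.mulVec x ≠ 0 := by
          apply norm_pos_iff.1
          exact lt_of_lt_of_le (by positivity) h
        obtain ⟨m', hm', B, hB, h'⟩ := hstep _ hne
        refine ⟨m' + m, by rw [Nat.mul_succ]; omega, B * A, ?_, ?_⟩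
        · rw [pow_add]; exact Set.mul_mem_mul hB hA
        · rw [← Matrix.mulVec_mulVec, pow_succ]
          linarith
    obtain ⟨r, hr1, hr2⟩ : ∃ r : ℝ, 1 < r ∧ r ^ N < 2 := by
      have hc : Tendsto (fun r : ℝ => r ^ N) (nhdsWithin 1 (Set.Ioi 1)) (nhds (1 ^ N)) :=
        ((continuous_pow N).tendsto 1).mono_left nhdsWithin_le_nhds
      rw [one_pow] at hc
      have h1 := hc.eventually (gt_mem_nhds (show (1 : ℝ) < 2 by norm_num))
      obtain ⟨r, h, h'⟩ := (h1.and self_mem_nhdsWithin).exists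
      exact ⟨r, h', h⟩
    obtain ⟨C, hC0, hC⟩ := aux_growth hS hρ hr1
    have hrN : 0 < r ^ N := by positivity
    obtain ⟨k, hk⟩ := pow_unbounded_of_one_lt C ((one_lt_div hrN).2 hr2)
    obtain ⟨m, hm, A, hA, h⟩ := hiter k
    have h1 : ‖A.mulVec x‖ ≤ (C * r ^ (N * k)) * ‖x‖ := by
      refine (Matrix.linfty_opNorm_mulVec A x).trans ?_
      refine mul_le_mul_of_nonneg_right ((hC m A hA).trans ?_) hnx.le
      exact mul_le_mul_of_nonneg_left (pow_le_pow_right₀ hr1.le hm) hC0.le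
    have h2 : (2 : ℝ) ^ k ≤ C * r ^ (N * k) := le_of_mul_le_mul_right (h.trans h1) hnx
    rw [div_pow, lt_div_iff₀ (by positivity), ← pow_mul] at hk
    linarith

lemma aux_mem_tail {d : ℕ} {S : Set (Matrix (Fin d) (Fin d) ℂ)} {n : ℕ}
    {A : Matrix (Fin d) (Fin d) ℂ} :
    A ∈ S ^ (n + 1) * genSemigroup S ↔ ∃ m, n + 2 ≤ m ∧ A ∈ S ^ m := by
  constructor
  · intro h
    obtain ⟨B, hB, D, hD, rfl⟩ := Set.mem_mul.1 h
    obtain ⟨k, hk⟩ := Set.mem_iUnion.1 hD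
    refine ⟨(n + 1) + (k + 1), by omega, ?_⟩
    rw [pow_add]
    exact Set.mul_mem_mul hB hk
  · rintro ⟨m, hm, hA⟩
    obtain ⟨k, rfl⟩ := Nat.exists_eq_add_of_le hm
    have : n + 2 + k = (n + 1) + (k + 1) := by ring
    rw [this, pow_add] at hA
    obtain ⟨B, hB, D, hD, rfl⟩ := Set.mem_mul.1 hA
    exact Set.mul_mem_mul hB (Set.mem_iUnion.2 ⟨k, hD⟩)

/-- The tails of the semigroup. -/
def auxTail {d : ℕ} (S : Set (Matrix (Fin d) (Fin d) ℂ)) (n : ℕ) :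
    Set (Matrix (Fin d) (Fin d) ℂ) := closure (S ^ (n + 1) * genSemigroup S)

lemma aux_tail_anti {d : ℕ} (S : Set (Matrix (Fin d) (Fin d) ℂ)) : Antitone (auxTail S) := by
  intro a b hab
  apply closure_mono
  intro A hA
  obtain ⟨m, hm, h⟩ := aux_mem_tail.1 hA
  exact aux_mem_tail.2 ⟨m, by omega, h⟩

lemma aux_mem_attractor {d : ℕ} {S : Set (Matrix (Fin d) (Fin d) ℂ)}
    {A : Matrix (Fin d) (Fin d) ℂ} : A ∈ attractor S ↔ ∀ n, A ∈ auxTail S n := Set.mem_iInter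

lemma aux_left_ideal {d : ℕ} {S : Set (Matrix (Fin d) (Fin d) ℂ)}
    {A s : Matrix (Fin d) (Fin d) ℂ} (hA : A ∈ attractor S) (hs : s ∈ S) :
    s * A ∈ attractor S := by
  rw [aux_mem_attractor] at hA ⊢
  intro n
  refine map_mem_closure (f := fun X => s * X) (continuous_const_mul s) (hA n) ?_
  intro X hX
  obtain ⟨m, hm, h⟩ := aux_mem_tail.1 hX
  refine aux_mem_tail.2 ⟨m + 1, by omega, ?_⟩
  rw [pow_succ']
  exact Set.mul_mem_mul hs h

lemma aux_right_ideal {d : ℕ} {S : Set (Matrix (Fin d) (Fin d) ℂ)}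
    {A s : Matrix (Fin d) (Fin d) ℂ} (hA : A ∈ attractor S) (hs : s ∈ S) :
    A * s ∈ attractor S := by
  rw [aux_mem_attractor] at hA ⊢
  intro n
  refine map_mem_closure (f := fun X => X * s) (continuous_mul_const s) (hA n) ?_
  intro X hX
  obtain ⟨m, hm, h⟩ := aux_mem_tail.1 hX
  refine aux_mem_tail.2 ⟨m + 1, by omega, ?_⟩
  rw [pow_succ]
  exact Set.mul_mem_mul h hs

lemma aux_mul_mem {d : ℕ} {S : Set (Matrix (Fin d) (Fin d) ℂ)}
    {A B : Matrix (Fin d) (Fin d) ℂ} (hA : A ∈ attractor S) (hB : B ∈ attractor S) :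
    A * B ∈ attractor S := by
  rw [aux_mem_attractor] at hA hB ⊢
  intro n
  refine map_mem_closure₂ (f := fun X Y => X * Y) continuous_mul (hA n) (hB n) ?_
  intro X hX Y hY
  obtain ⟨m, hm, h⟩ := aux_mem_tail.1 hX
  obtain ⟨k, hk, h'⟩ := aux_mem_tail.1 hY
  refine aux_mem_tail.2 ⟨m + k, by omega, ?_⟩
  rw [pow_add]
  exact Set.mul_mem_mul h h'

lemma aux_tail_norm {d : ℕ} {S : Set (Matrix (Fin d) (Fin d) ℂ)} {C : ℝ}
    (hC : ∀ m, ∀ A ∈ S ^ m, ‖A‖ ≤ C) (n : ℕ) : ∀ A ∈ auxTail S n, ‖A‖ ≤ C := by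
  intro A hA
  have : auxTail S n ⊆ {X | ‖X‖ ≤ C} := by
    apply closure_minimal
    · intro X hX
      obtain ⟨m, _, h⟩ := aux_mem_tail.1 hX
      exact hC m X h
    · exact isClosed_le continuous_norm continuous_const
  exact this hA

lemma aux_tail_compact {d : ℕ} {S : Set (Matrix (Fin d) (Fin d) ℂ)} {C : ℝ}
    (hC : ∀ m, ∀ A ∈ S ^ m, ‖A‖ ≤ C) (n : ℕ) : IsCompact (auxTail S n) := by
  have : ProperSpace (Matrix (Fin d) (Fin d) ℂ) := FiniteDimensional.proper ℂ _
  refine Metric.isCompact_of_isClosed_isBounded isClosed_closure ?_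
  exact isBounded_iff_forall_norm_le.2 ⟨C, aux_tail_norm hC n⟩

/-- The attractor contains an element of norm at least one. -/
lemma aux_exists_norm {d : ℕ} {S : Set (Matrix (Fin d) (Fin d) ℂ)} {C : ℝ}
    (hC : ∀ m, ∀ A ∈ S ^ m, ‖A‖ ≤ C) (hρ : jsr S = 1) :
    ∃ A ∈ attractor S, 1 ≤ ‖A‖ := by
  have hsup : ∀ n : ℕ, 1 ≤ sSup (norm '' (S ^ (n + 1))) := by
    intro n
    have h0 : 0 ≤ sSup (norm '' (S ^ (n + 1))) := by
      apply Real.sSup_nonneg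
      rintro _ ⟨A, _, rfl⟩
      exact norm_nonneg _
    have h1 : jsr S ≤ setOpNorm stdNorm (S ^ (n + 1)) ^ (1 / (n + 1 : ℝ)) := by
      refine ciInf_le ⟨0, ?_⟩ n
      rintro _ ⟨k, rfl⟩
      apply Real.rpow_nonneg
      rw [aux_setOpNorm_eq]
      apply Real.sSup_nonneg
      rintro _ ⟨A, _, rfl⟩
      exact norm_nonneg _
    rw [hρ, aux_setOpNorm_eq] at h1
    by_contra hlt
    push Not at hlt
    exact absurd (Real.rpow_lt_one h0 hlt (by positivity : (0 : ℝ) < 1 / (n + 1 : ℝ)))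
      (not_lt.2 h1)
  have hne : ∀ n : ℕ, (S ^ (n + 1)).Nonempty := by
    intro n
    by_contra h
    have := hsup n
    rw [Set.not_nonempty_iff_eq_empty.1 h] at this
    simp at this
    linarith
  have hex : ∀ n : ℕ, (auxTail S n ∩ {X | 1 ≤ ‖X‖}).Nonempty := by
    intro n
    have hsub : S ^ (n + 1 + 1) ⊆ auxTail S n := fun X hX =>
      subset_closure (aux_mem_tail.2 ⟨n + 2, le_rfl, hX⟩)
    obtain ⟨A, hA, hmax⟩ := (aux_tail_compact hC n).exists_isMaxOn
      ((hne (n + 1)).mono hsub) continuous_norm.continuousOn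
    refine ⟨A, hA, (hsup (n + 1)).trans ?_⟩
    apply csSup_le ((hne (n + 1)).image _)
    rintro _ ⟨X, hX, rfl⟩
    exact hmax (hsub hX)
  have hcl : IsClosed {X : Matrix (Fin d) (Fin d) ℂ | 1 ≤ ‖X‖} :=
    isClosed_le continuous_const continuous_norm
  obtain ⟨A, hA⟩ := IsCompact.nonempty_iInter_of_sequence_nonempty_isCompact_isClosed
    (fun n => auxTail S n ∩ {X | 1 ≤ ‖X‖})
    (fun n => Set.inter_subset_inter_left _ (aux_tail_anti S (Nat.le_succ n))) hex
    ((aux_tail_compact hC 0).inter_right hcl) (fun n => isClosed_closure.inter hcl)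
  rw [Set.mem_iInter] at hA
  exact ⟨A, aux_mem_attractor.2 fun n => (hA n).1, (hA 0).2⟩

/-- Every element of the attractor factors. -/
lemma aux_factor {d : ℕ} {S : Set (Matrix (Fin d) (Fin d) ℂ)} {C : ℝ}
    (hC : ∀ m, ∀ A ∈ S ^ m, ‖A‖ ≤ C) {A : Matrix (Fin d) (Fin d) ℂ} (hA : A ∈ attractor S) :
    ∃ B ∈ attractor S, ∃ D ∈ attractor S, B * D = A := by
  rw [aux_mem_attractor] at hA
  have hcl : IsClosed {p : Matrix (Fin d) (Fin d) ℂ × Matrix (Fin d) (Fin d) ℂ | p.1 * p.2 = A} :=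
    isClosed_eq (continuous_fst.mul continuous_snd) continuous_const
  have hK : ∀ n, auxTail S (2 * n + 2) ⊆ auxTail S n * auxTail S n := by
    intro n
    apply closure_minimal
    · intro X hX
      obtain ⟨m, hm, h⟩ := aux_mem_tail.1 hX
      obtain ⟨k, rfl⟩ := Nat.exists_eq_add_of_le hm
      have : 2 * n + 2 + 2 + k = (n + 2) + (n + 2 + k) := by ring
      rw [this, pow_add] at h
      obtain ⟨B, hB, D, hD, rfl⟩ := Set.mem_mul.1 h
      exact Set.mul_mem_mul (subset_closure (aux_mem_tail.2 ⟨_, le_rfl, hB⟩))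
        (subset_closure (aux_mem_tail.2 ⟨_, Nat.le_add_right _ _, hD⟩))
    · exact ((aux_tail_compact hC n).mul (aux_tail_compact hC n)).isClosed
  obtain ⟨p, hp⟩ := IsCompact.nonempty_iInter_of_sequence_nonempty_isCompact_isClosed
    (fun n => (auxTail S n ×ˢ auxTail S n) ∩ {p | p.1 * p.2 = A})
    (fun n => Set.inter_subset_inter_left _ (Set.prod_mono (aux_tail_anti S (Nat.le_succ n))
      (aux_tail_anti S (Nat.le_succ n))))
    (fun n => by
      obtain ⟨B, hB, D, hD, h⟩ := Set.mem_mul.1 (hK n (hA _))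
      exact ⟨(B, D), ⟨hB, hD⟩, h⟩)
    (((aux_tail_compact hC 0).prod (aux_tail_compact hC 0)).inter_right hcl)
    (fun n => (isClosed_closure.prod isClosed_closure).inter hcl)
  rw [Set.mem_iInter] at hp
  exact ⟨p.1, aux_mem_attractor.2 fun n => (hp n).1.1, p.2,
    aux_mem_attractor.2 fun n => (hp n).1.2, (hp 0).2⟩

lemma aux_pow_eq {d : ℕ} {S : Set (Matrix (Fin d) (Fin d) ℂ)} {C : ℝ}
    (hC : ∀ m, ∀ A ∈ S ^ m, ‖A‖ ≤ C) (n : ℕ) : attractor S ^ (n + 1) = attractor S := by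
  have hsq : attractor S * attractor S = attractor S := by
    apply Set.Subset.antisymm
    · intro X hX
      obtain ⟨B, hB, D, hD, rfl⟩ := Set.mem_mul.1 hX
      exact aux_mul_mem hB hD
    · intro X hX
      obtain ⟨B, hB, D, hD, rfl⟩ := aux_factor hC hX
      exact Set.mul_mem_mul hB hD
  induction n with
  | zero => simp
  | succ n ih => rw [pow_succ, ih, hsq]

lemma aux_irred {d : ℕ} {S : Set (Matrix (Fin d) (Fin d) ℂ)} (hirr : IsIrred S)
    (hne : ∃ A ∈ attractor S, 1 ≤ ‖A‖) : IsIrred (attractor S) := by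
  intro W hW
  let W₁ : Submodule ℂ (Fin d → ℂ) :=
    Submodule.span ℂ {y | ∃ A ∈ attractor S, ∃ x ∈ W, y = A.mulVec x}
  have h1 : ∀ s ∈ S, ∀ x ∈ W₁, s.mulVec x ∈ W₁ := by
    intro s hs x hx
    have : W₁ ≤ W₁.comap s.mulVecLin := by
      apply Submodule.span_le.2
      rintro _ ⟨A, hA, x, hx, rfl⟩
      simp only [Submodule.comap_coe, Set.mem_preimage, Matrix.mulVecLin_apply, SetLike.mem_coe]
      rw [Matrix.mulVec_mulVec]
      exact Submodule.subset_span ⟨s * A, aux_left_ideal hA hs, x, hx, rfl⟩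
    exact this hx
  have hle : W₁ ≤ W := by
    apply Submodule.span_le.2
    rintro _ ⟨A, hA, x, hx, rfl⟩
    exact hW A hA x hx
  rcases hirr W₁ h1 with hb | ht
  · left
    let W₂ : Submodule ℂ (Fin d → ℂ) :=
      { carrier := {x | ∀ A ∈ attractor S, A.mulVec x = 0}
        zero_mem' := fun A _ => by simp
        add_mem' := by
          intro x y hx hy A hA
          rw [Matrix.mulVec_add, hx A hA, hy A hA, add_zero]
        smul_mem' := by
          intro a x hx A hA
          rw [Matrix.mulVec_smul, hx A hA, smul_zero] }
    have h2 : ∀ s ∈ S, ∀ x ∈ W₂, s.mulVec x ∈ W₂ := by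
      intro s hs x hx A hA
      rw [Matrix.mulVec_mulVec]
      exact hx _ (aux_right_ideal hA hs)
    have hle2 : W ≤ W₂ := by
      intro x hx A hA
      have : A.mulVec x ∈ W₁ := Submodule.subset_span ⟨A, hA, x, hx, rfl⟩
      rwa [hb, Submodule.mem_bot] at this
    rcases hirr W₂ h2 with hb2 | ht2
    · rw [hb2] at hle2
      exact le_bot_iff.1 hle2
    · exfalso
      obtain ⟨A, hA, hn⟩ := hne
      have hz : A = 0 := by
        apply Matrix.ext_of_mulVec_single
        intro i
        have : (Pi.single i 1 : Fin d → ℂ) ∈ W₂ := by rw [ht2]; trivial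
        rw [this A hA, Matrix.zero_mulVec]
      rw [hz, norm_zero] at hn
      linarith
  · right
    rw [ht] at hle
    exact top_le_iff.1 hle

lemma aux_jsr {d : ℕ} {S : Set (Matrix (Fin d) (Fin d) ℂ)} {C : ℝ} (hC1 : 1 ≤ C)
    (hC : ∀ m, ∀ A ∈ S ^ m, ‖A‖ ≤ C) (hne : ∃ A ∈ attractor S, 1 ≤ ‖A‖) :
    jsr (attractor S) = 1 := by
  have hbd : ∀ A ∈ attractor S, ‖A‖ ≤ C := fun A hA =>
    aux_tail_norm hC 0 A (aux_mem_attractor.1 hA 0)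
  obtain ⟨A, hA, hn⟩ := hne
  have hge : 1 ≤ sSup (norm '' attractor S) := by
    refine hn.trans (le_csSup ⟨C, ?_⟩ ⟨A, hA, rfl⟩)
    rintro _ ⟨B, hB, rfl⟩
    exact hbd B hB
  have hle : sSup (norm '' attractor S) ≤ C := by
    apply csSup_le (Set.Nonempty.image norm ⟨A, hA⟩)
    rintro _ ⟨B, hB, rfl⟩
    exact hbd B hB
  unfold jsr
  simp only [aux_pow_eq hC, aux_setOpNorm_eq]
  have hlow : ∀ n : ℕ, 1 ≤ sSup (norm '' attractor S) ^ (1 / (n + 1 : ℝ)) := fun n =>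
    Real.one_le_rpow hge (by positivity)
  apply le_antisymm
  · have ht : Tendsto (fun n : ℕ => sSup (norm '' attractor S) ^ (1 / ((n : ℝ) + 1))) atTop
        (nhds (sSup (norm '' attractor S) ^ (0 : ℝ))) :=
      tendsto_const_nhds.rpow tendsto_one_div_add_atTop_nhds_zero_nat (Or.inl (by linarith))
    rw [Real.rpow_zero] at ht
    refine ge_of_tendsto' ht fun n => ciInf_le ⟨1, ?_⟩ n
    rintro _ ⟨k, rfl⟩
    exact hlow k
  · exact le_ciInf hlow

end Helpers

/-- if `S` is bounded, irreducible and `ρ(S) = 1`, then the attractor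
semigroup `T_∞` is irreducible and `ρ(T_∞) = 1`. -/
theorem stmt_7 {d : ℕ} (S : Set (Matrix (Fin d) (Fin d) ℂ)) (hS : MatBdd S)
    (hirr : IsIrred S) (hρ : jsr S = 1) :
    IsIrred (attractor S) ∧ jsr (attractor S) = 1 := by
  obtain ⟨C, hC1, hC⟩ := aux_semigroup_bdd hS hirr hρ
  have hne := aux_exists_norm hC hρ
  exact ⟨aux_irred hirr hne, aux_jsr hC1 hC hne⟩
end

section
/- Let S ⊂ M_d(ℂ) be a bounded subset with ρ(S) > 0. Then limsup_{n→∞} Λ(Sⁿ)/ρ(S)ⁿ = 1, where Λ(Q) := sup_{q∈Q} Λ(q) and Λ(q) is the spectral radius of the matrix q. -/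
open scoped Pointwise
open Filter

namespace JSRAux

variable {ι E F : Type*}

/-- Product of the operators along a word. -/
noncomputable def wd [AddCommGroup E] [Module ℂ E] (T : ι → Module.End ℂ E) (w : List ι) :
    Module.End ℂ E := (w.map T).prod

/-- Growth of the products is at most exponential with rate `r`. -/
def Grow [NormedAddCommGroup E] [NormedSpace ℂ E] (T : ι → Module.End ℂ E) (r : ℝ) : Prop :=
  ∃ C : ℝ, 1 ≤ C ∧ ∀ w x, ‖wd T w x‖ ≤ C * r ^ w.length * ‖x‖

/-- All the products of some fixed length are contractions by one half. -/
def Small [NormedAddCommGroup E] [NormedSpace ℂ E] (T : ι → Module.End ℂ E) : Prop :=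
  ∃ n : ℕ, 1 ≤ n ∧ ∀ w : List ι, w.length = n → ∀ x, ‖wd T w x‖ ≤ ‖x‖ / 2

/-- The desired conclusion: long products with almost maximal eigenvalue. -/
def Good [AddCommGroup E] [Module ℂ E] (T : ι → Module.End ℂ E) : Prop :=
  ∀ ε : ℝ, 0 < ε → ∀ N : ℕ, ∃ w : List ι, N ≤ w.length ∧
    ∃ μ : ℂ, (wd T w).HasEigenvalue μ ∧ 1 - ε ≤ ‖μ‖

theorem wd_append [AddCommGroup E] [Module ℂ E] (T : ι → Module.End ℂ E) (u v : List ι) (x : E) :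
    wd T (u ++ v) x = wd T u (wd T v x) := by
  simp [wd]

theorem wd_nil [AddCommGroup E] [Module ℂ E] (T : ι → Module.End ℂ E) (x : E) :
    wd T [] x = x := by
  simp [wd]

theorem wd_cons [AddCommGroup E] [Module ℂ E] (T : ι → Module.End ℂ E) (i : ι) (v : List ι)
    (x : E) : wd T (i :: v) x = T i (wd T v x) := by
  simp [wd]

theorem wd_semiconj [AddCommGroup E] [Module ℂ E] [AddCommGroup F] [Module ℂ F]
    (T : ι → Module.End ℂ E) (T' : ι → Module.End ℂ F) (φ : E →ₗ[ℂ] F)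
    (h : ∀ i x, φ (T i x) = T' i (φ x)) (w : List ι) (x : E) :
    φ (wd T w x) = wd T' w (φ x) := by
  induction w with
  | nil => simp [wd_nil]
  | cons i w ih => rw [wd_cons, wd_cons, h, ih]

theorem near_fix [NormedAddCommGroup E] [NormedSpace ℂ E] [FiniteDimensional ℂ E]
    (T : ι → Module.End ℂ E) (C : ℝ) (hC : 1 ≤ C) (hb : ∀ w x, ‖wd T w x‖ ≤ C * ‖x‖)
    (hs : ¬ Small T) (N : ℕ) (δ : ℝ) (hδ : 0 < δ) :
    ∃ w : List ι, N ≤ w.length ∧ ∃ y : E, 1 / (2 * C) ≤ ‖y‖ ∧ ‖y‖ ≤ C ∧ ‖wd T w y - y‖ ≤ δ := by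
  have : ProperSpace E := FiniteDimensional.proper ℂ E
  obtain ⟨t, -, htf, ht⟩ := (isCompact_closedBall (0 : E) C).finite_cover_balls (half_pos hδ)
  obtain ⟨m, hm⟩ : ∃ m, m = N + 1 := ⟨_, rfl⟩
  obtain ⟨K, hK⟩ : ∃ K, K = htf.toFinset.card + 1 := ⟨_, rfl⟩
  have h1 : ∃ w : List ι, w.length = K * m ∧ ∃ x, ‖x‖ / 2 < ‖wd T w x‖ := by
    by_contra hcon
    push Not at hcon
    exact hs ⟨K * m, by subst hK hm; nlinarith [Nat.zero_le (htf.toFinset.card * N)], hcon⟩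
  obtain ⟨w, hw, x0, hx0⟩ := h1
  have hx0' : x0 ≠ 0 := by
    rintro rfl
    simp at hx0
  have hx0n : 0 < ‖x0‖ := norm_pos_iff.2 hx0'
  obtain ⟨x, hx1, hx⟩ : ∃ x : E, ‖x‖ = 1 ∧ 1 / 2 < ‖wd T w x‖ := by
    refine ⟨((‖x0‖⁻¹ : ℝ) : ℂ) • x0, ?_, ?_⟩
    · rw [norm_smul]; simp [hx0n.ne']
    · rw [map_smul, norm_smul]
      simp only [Complex.norm_real, norm_inv, norm_norm]
      rw [inv_mul_eq_div, lt_div_iff₀ hx0n]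
      linarith
  have hyC : ∀ v, ‖wd T v x‖ ≤ C := fun v => by simpa [hx1] using hb v x
  have hsel : ∀ j : ℕ, ∃ p ∈ htf.toFinset, ‖wd T (w.drop (j * m)) x - p‖ < δ / 2 := by
    intro j
    have := ht (show wd T (w.drop (j * m)) x ∈ Metric.closedBall (0 : E) C by
      simpa using hyC _)
    simp only [Set.mem_iUnion, Metric.mem_ball, dist_eq_norm] at this
    obtain ⟨p, hp, hp'⟩ := this
    exact ⟨p, by simpa using hp, hp'⟩
  choose f hf hf' using hsel
  have hpig := Finset.exists_ne_map_eq_of_card_lt_of_maps_to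
    (s := Finset.range K) (t := htf.toFinset) (f := f) (by simp [hK]) (fun j _ => hf j)
  have : ∃ i j, i < j ∧ j < K ∧ f i = f j := by
    obtain ⟨i, hi, j, hj, hij, he⟩ := hpig
    simp only [Finset.mem_range] at hi hj
    rcases lt_or_gt_of_ne hij with h | h
    · exact ⟨i, j, h, hj, he⟩
    · exact ⟨j, i, h, hi, he.symm⟩
  obtain ⟨i, j, hij, hjK, he⟩ := this
  have hle : j * m ≤ K * m := Nat.mul_le_mul_right _ hjK.le
  obtain ⟨k, rfl⟩ : ∃ k, j = i + (k + 1) := ⟨j - i - 1, by omega⟩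
  have hsplit : w.drop (i * m) = (w.drop (i * m)).take ((k + 1) * m)
      ++ w.drop ((i + (k + 1)) * m) := by
    conv_lhs => rw [← List.take_append_drop ((k + 1) * m) (w.drop (i * m))]
    rw [List.drop_drop, add_mul i]
  refine ⟨(w.drop (i * m)).take ((k + 1) * m), ?_, wd T (w.drop ((i + (k + 1)) * m)) x, ?_,
    hyC _, ?_⟩
  · rw [List.length_take, List.length_drop, hw]
    have : K * m - i * m ≥ (k + 1) * m := by
      rw [add_mul] at hle; omega
    rw [min_eq_left this]
    nlinarith [Nat.zero_le (k * m)]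
  · have h2 : wd T w x = wd T (w.take ((i + (k + 1)) * m)) (wd T (w.drop ((i + (k + 1)) * m)) x) := by
      rw [← wd_append, List.take_append_drop]
    have h3 := hb (w.take ((i + (k + 1)) * m)) (wd T (w.drop ((i + (k + 1)) * m)) x)
    rw [← h2] at h3
    rw [div_le_iff₀ (by linarith)]
    linarith
  · rw [← wd_append, ← hsplit]
    have h4 := hf' i
    have h5 := hf' (i + (k + 1))
    rw [← he] at h5
    calc _ = ‖(wd T (w.drop (i * m)) x - f i) - (wd T (w.drop ((i + (k + 1)) * m)) x - f i)‖ := by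
          congr 1; abel
      _ ≤ _ := norm_sub_le _ _
      _ ≤ δ := by linarith

theorem det_lower [NormedAddCommGroup E] [NormedSpace ℂ E] [FiniteDimensional ℂ E]
    (Q : Module.End ℂ E) (ε : ℝ) (hε : 0 < ε) (h : ∀ μ : ℂ, Q.HasEigenvalue μ → ‖μ‖ ≤ 1 - ε) :
    ε ^ Module.finrank ℂ E ≤ ‖LinearMap.det (1 - Q)‖ := by
  have h1 := LinearMap.eval_charpoly Q 1
  rw [map_one] at h1
  have hsp : Q.charpoly.Splits := IsAlgClosed.splits _
  rw [← h1, hsp.eval_eq_prod_roots_of_monic Q.charpoly_monic]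
  have hc : Q.charpoly.roots.card = Module.finrank ℂ E := by
    rw [← LinearMap.charpoly_natDegree Q, hsp.natDegree_eq_card_roots]
  rw [← hc]
  have hr : ∀ μ ∈ Q.charpoly.roots, ε ≤ ‖1 - μ‖ := by
    intro μ hμ
    have := h μ ((Module.End.hasEigenvalue_iff_isRoot_charpoly Q μ).2 (Polynomial.isRoot_of_mem_roots hμ))
    have h2 := norm_sub_norm_le (1 : ℂ) μ
    simp at h2
    linarith
  generalize Q.charpoly.roots = s at hr
  induction s using Multiset.induction_on with
  | empty => simp
  | cons a s ih =>
    rw [Multiset.map_cons, Multiset.prod_cons, norm_mul, Multiset.card_cons, pow_succ']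
    exact mul_le_mul (hr a (by simp)) (ih fun μ hμ => hr μ (by simp [hμ])) (by positivity)
      (by positivity)

theorem good_of_bounded [NormedAddCommGroup E] [NormedSpace ℂ E] [FiniteDimensional ℂ E]
    (T : ι → Module.End ℂ E) (hb : Grow T 1) (hs : ¬ Small T) : Good T := by
  obtain ⟨C, hC, hb⟩ := hb
  simp only [one_pow, mul_one] at hb
  intro ε hε N
  by_contra hcon
  push Not at hcon
  have := fun k : ℕ => near_fix T C hC hb hs N (1 / ((k : ℝ) + 1)) (by positivity)
  choose w hwN y hy1 hy2 hy3 using this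
  have : ProperSpace E := FiniteDimensional.proper ℂ E
  have : ProperSpace (E →L[ℂ] E) := FiniteDimensional.proper ℂ _
  let Q : ℕ → E →L[ℂ] E := fun k => LinearMap.toContinuousLinearMap (wd T (w k))
  have hQ : ∀ k x, Q k x = wd T (w k) x := fun k x => rfl
  have hcomp := ((isCompact_closedBall (0 : E →L[ℂ] E) C).prod (isCompact_closedBall (0 : E) C))
  obtain ⟨⟨A, z⟩, -, φ, hφ, hlim⟩ := hcomp.tendsto_subseq (x := fun k => (Q k, y k)) (fun k => by
    refine ⟨?_, ?_⟩
    · simp only [mem_closedBall_zero_iff]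
      exact ContinuousLinearMap.opNorm_le_bound _ (by linarith) (fun x => hb _ x)
    · simpa using hy2 k)
  have hA : Tendsto (fun k => Q (φ k)) atTop (nhds A) := (continuous_fst.tendsto _).comp hlim
  have hz : Tendsto (fun k => y (φ k)) atTop (nhds z) := (continuous_snd.tendsto _).comp hlim
  have hAz : Tendsto (fun k => Q (φ k) (y (φ k))) atTop (nhds (A z)) := by
    have : Continuous fun p : (E →L[ℂ] E) × E => p.1 p.2 := by fun_prop
    exact (this.tendsto (A, z)).comp hlim
  have h0 : Tendsto (fun k => Q (φ k) (y (φ k)) - y (φ k)) atTop (nhds 0) := by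
    have h1 : Tendsto (fun k => (1 : ℝ) / (((φ k : ℕ) : ℝ) + 1)) atTop (nhds 0) :=
      tendsto_one_div_add_atTop_nhds_zero_nat.comp hφ.tendsto_atTop
    exact squeeze_zero_norm (fun k => hy3 (φ k)) h1
  have hfix : A z - z = 0 := tendsto_nhds_unique (hAz.sub hz) h0
  have hz0 : z ≠ 0 := by
    have : 1 / (2 * C) ≤ ‖z‖ := ge_of_tendsto' hz.norm (fun k => hy1 _)
    have h2 : 0 < 1 / (2 * C) := by positivity
    exact norm_pos_iff.1 (h2.trans_le this)
  have hdet : (1 - A).det = 0 := by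
    by_contra hne
    have hu : IsUnit (LinearMap.det ((1 - A : E →L[ℂ] E) : E →ₗ[ℂ] E)) := isUnit_iff_ne_zero.2 hne
    have := ((LinearMap.isUnit_iff_isUnit_det _).2 hu)
    have hk := (Module.End.isUnit_iff _).1 this
    apply hz0
    apply hk.1
    simp [sub_eq_zero.1 hfix]
  have hdl : Tendsto (fun k => ‖(1 - Q (φ k)).det‖) atTop (nhds ‖(1 - A).det‖) :=
    ((ContinuousLinearMap.continuous_det.tendsto _).comp (tendsto_const_nhds.sub hA)).norm
  have hge : ε ^ Module.finrank ℂ E ≤ ‖(1 - A).det‖ := by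
    refine ge_of_tendsto' hdl fun k => ?_
    exact det_lower (wd T (w (φ k))) ε hε (fun μ hμ => (hcon _ (hwN _) μ hμ).le)
  rw [hdet, norm_zero] at hge
  exact absurd hge (not_le.2 (by positivity))

theorem exists_root (n : ℕ) : ∃ r : ℝ, 1 < r ∧ r ^ n ≤ 3 / 2 := by
  refine ⟨(3 / 2 : ℝ) ^ (1 / ((n : ℝ) + 1)), Real.one_lt_rpow (by norm_num) (by positivity), ?_⟩
  rw [← Real.rpow_natCast, ← Real.rpow_mul (by norm_num)]
  calc (3 / 2 : ℝ) ^ (1 / ((n : ℝ) + 1) * n) ≤ (3 / 2 : ℝ) ^ (1 : ℝ) := by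
        apply Real.rpow_le_rpow_of_exponent_le (by norm_num)
        rw [one_div, inv_mul_le_iff₀ (by positivity)]
        linarith
    _ = 3 / 2 := by simp

/-- The subspace of vectors with bounded orbit. -/
def bddSub [NormedAddCommGroup E] [NormedSpace ℂ E] (T : ι → Module.End ℂ E) :
    Submodule ℂ E where
  carrier := {x | ∃ C : ℝ, ∀ w, ‖wd T w x‖ ≤ C}
  zero_mem' := ⟨0, by simp⟩
  add_mem' := by
    rintro x y ⟨C, hC⟩ ⟨D, hD⟩
    refine ⟨C + D, fun w => ?_⟩
    rw [map_add]
    exact (norm_add_le _ _).trans (add_le_add (hC w) (hD w))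
  smul_mem' := by
    rintro a x ⟨C, hC⟩
    refine ⟨‖a‖ * C, fun w => ?_⟩
    rw [map_smul, norm_smul]
    exact mul_le_mul_of_nonneg_left (hC w) (norm_nonneg _)

theorem bddSub_inv [NormedAddCommGroup E] [NormedSpace ℂ E] (T : ι → Module.End ℂ E) (i : ι) :
    ∀ x ∈ bddSub T, T i x ∈ bddSub T := by
  rintro x ⟨C, hC⟩
  refine ⟨C, fun w => ?_⟩
  have := hC (w ++ [i])
  rwa [wd_append, wd_cons, wd_nil] at this

theorem bddSub_ne_bot [NormedAddCommGroup E] [NormedSpace ℂ E] [FiniteDimensional ℂ E]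
    [Nontrivial E] (T : ι → Module.End ℂ E) (hg : ∀ r : ℝ, 1 < r → Grow T r) :
    bddSub T ≠ ⊥ := by
  intro hbot
  have : ProperSpace E := FiniteDimensional.proper ℂ E
  have hex : ∀ x : E, x ≠ 0 → ∃ w, 2 < ‖wd T w x‖ := by
    intro x hx
    by_contra hcon
    push Not at hcon
    have : x ∈ bddSub T := ⟨2, hcon⟩
    rw [hbot] at this
    exact hx (by simpa using this)
  obtain ⟨t, ht⟩ := (isCompact_sphere (0 : E) 1).elim_finite_subcover
    (fun w : List ι => {x | 2 < ‖wd T w x‖})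
    (fun w => isOpen_lt continuous_const (LinearMap.continuous_of_finiteDimensional (wd T w)).norm)
    (fun x hx => by
      have hx1 : ‖x‖ = 1 := by simpa using hx
      obtain ⟨w, hw⟩ := hex x (by rintro rfl; simp at hx1)
      exact Set.mem_iUnion.2 ⟨w, hw⟩)
  obtain ⟨L, hL⟩ : ∃ L : ℕ, ∀ w ∈ t, w.length ≤ L :=
    ⟨t.sup List.length, fun w hw => Finset.le_sup (f := List.length) hw⟩
  have hstep : ∀ x : E, ∃ w : List ι, w.length ≤ L ∧ 2 * ‖x‖ ≤ ‖wd T w x‖ := by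
    intro x
    by_cases hx : x = 0
    · exact ⟨[], by simp, by simp [hx]⟩
    have hxn : 0 < ‖x‖ := norm_pos_iff.2 hx
    have := ht (show ((‖x‖⁻¹ : ℝ) : ℂ) • x ∈ Metric.sphere (0 : E) 1 by
      simp [norm_smul, hxn.ne'])
    simp only [Set.mem_iUnion] at this
    obtain ⟨w, hw, hw2⟩ := this
    refine ⟨w, hL w hw, ?_⟩
    rw [Set.mem_ofPred_eq, map_smul, norm_smul] at hw2
    simp only [Complex.norm_real, norm_inv, norm_norm] at hw2
    rw [inv_mul_eq_div, lt_div_iff₀ hxn] at hw2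
    exact hw2.le
  obtain ⟨x, hx⟩ := exists_ne (0 : E)
  have hxn : 0 < ‖x‖ := norm_pos_iff.2 hx
  have hit : ∀ k : ℕ, ∃ w : List ι, w.length ≤ L * k ∧ 2 ^ k * ‖x‖ ≤ ‖wd T w x‖ := by
    intro k
    induction k with
    | zero => exact ⟨[], by simp, by simp [wd_nil]⟩
    | succ k ih =>
      obtain ⟨w, hw, hw2⟩ := ih
      obtain ⟨u, hu, hu2⟩ := hstep (wd T w x)
      refine ⟨u ++ w, by rw [List.length_append, mul_add]; omega, ?_⟩
      rw [wd_append, pow_succ]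
      linarith
  obtain ⟨r, hr, hrL⟩ := exists_root L
  obtain ⟨C, hC, hgr⟩ := hg r hr
  have hle : ∀ k : ℕ, (4 / 3 : ℝ) ^ k ≤ C := by
    intro k
    obtain ⟨w, hw, hw2⟩ := hit k
    have h1 := hgr w x
    have h2 : r ^ w.length ≤ (3 / 2) ^ k :=
      (pow_le_pow_right₀ hr.le hw).trans (by
        rw [pow_mul]; exact pow_le_pow_left₀ (by positivity) hrL k)
    have h3 : (2 : ℝ) ^ k * ‖x‖ ≤ C * (3 / 2) ^ k * ‖x‖ :=
      hw2.trans (h1.trans (by gcongr))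
    have h4 : (2 : ℝ) ^ k ≤ C * (3 / 2) ^ k := le_of_mul_le_mul_right h3 hxn
    have h5 : (2 : ℝ) ^ k = (4 / 3) ^ k * (3 / 2) ^ k := by rw [← mul_pow]; norm_num
    rw [h5] at h4
    exact le_of_mul_le_mul_right h4 (by positivity)
  obtain ⟨k, hk⟩ := pow_unbounded_of_one_lt C (show (1 : ℝ) < 4 / 3 by norm_num)
  exact absurd (hle k) (not_le.2 hk)

/-- Restriction of the family to an invariant subspace. -/
noncomputable def resFam [AddCommGroup E] [Module ℂ E] (T : ι → Module.End ℂ E)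
    (W : Submodule ℂ E) (hW : ∀ i, ∀ x ∈ W, T i x ∈ W) : ι → Module.End ℂ W :=
  fun i => (T i).restrict (hW i)

/-- Family induced on the quotient by an invariant subspace. -/
noncomputable def quoFam [AddCommGroup E] [Module ℂ E] (T : ι → Module.End ℂ E)
    (W : Submodule ℂ E) (hW : ∀ i, ∀ x ∈ W, T i x ∈ W) : ι → Module.End ℂ (E ⧸ W) :=
  fun i => W.mapQ W (T i) (hW i)

theorem wd_res [AddCommGroup E] [Module ℂ E] (T : ι → Module.End ℂ E)
    (W : Submodule ℂ E) (hW : ∀ i, ∀ x ∈ W, T i x ∈ W) (w : List ι) (x : W) :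
    ((wd (resFam T W hW) w x : W) : E) = wd T w x :=
  wd_semiconj (resFam T W hW) T W.subtype (fun _ _ => rfl) w x

theorem wd_quo [AddCommGroup E] [Module ℂ E] (T : ι → Module.End ℂ E)
    (W : Submodule ℂ E) (hW : ∀ i, ∀ x ∈ W, T i x ∈ W) (w : List ι) (x : E) :
    wd (quoFam T W hW) w (Submodule.Quotient.mk x) = Submodule.Quotient.mk (wd T w x) :=
  (wd_semiconj T (quoFam T W hW) W.mkQ (fun _ _ => rfl) w x).symm

theorem good_of_res [AddCommGroup E] [Module ℂ E] (T : ι → Module.End ℂ E)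
    (W : Submodule ℂ E) (hW : ∀ i, ∀ x ∈ W, T i x ∈ W) (h : Good (resFam T W hW)) : Good T := by
  intro ε hε N
  obtain ⟨w, hw, μ, hμ, hn⟩ := h ε hε N
  refine ⟨w, hw, μ, ?_, hn⟩
  obtain ⟨v, hv⟩ := hμ.exists_hasEigenvector
  refine Module.End.hasEigenvalue_of_hasEigenvector (x := (v : E)) ?_
  rw [Module.End.hasEigenvector_iff, Module.End.mem_eigenspace_iff] at hv ⊢
  refine ⟨?_, by simpa using hv.2⟩
  rw [← wd_res T W hW, hv.1]
  rfl

theorem good_of_quo [AddCommGroup E] [Module ℂ E] [FiniteDimensional ℂ E]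
    (T : ι → Module.End ℂ E)
    (W : Submodule ℂ E) (hW : ∀ i, ∀ x ∈ W, T i x ∈ W) (h : Good (quoFam T W hW)) : Good T := by
  intro ε hε N
  obtain ⟨w, hw, μ, hμ, hn⟩ := h ε hε N
  refine ⟨w, hw, μ, ?_, hn⟩
  obtain ⟨v, hv⟩ := hμ.exists_hasEigenvector
  rw [Module.End.hasEigenvector_iff, Module.End.mem_eigenspace_iff] at hv
  rw [Module.End.hasEigenvalue_iff_mem_spectrum, spectrum.mem_iff]
  intro hu
  have hbij := (Module.End.isUnit_iff _).1 hu
  have hsur : Function.Surjective (algebraMap ℂ (Module.End ℂ (E ⧸ W)) μ - wd (quoFam T W hW) w) := by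
    intro z
    obtain ⟨z, rfl⟩ := Submodule.Quotient.mk_surjective W z
    obtain ⟨y, rfl⟩ := hbij.2 z
    refine ⟨Submodule.Quotient.mk y, ?_⟩
    simp [wd_quo, Module.algebraMap_end_apply]
  have hinj := LinearMap.injective_iff_surjective.2 hsur
  apply hv.2
  apply hinj
  simp [hv.1, Module.algebraMap_end_apply]

theorem small_iter [NormedAddCommGroup E] [NormedSpace ℂ E] (T : ι → Module.End ℂ E) (n : ℕ)
    (h : ∀ w : List ι, w.length = n → ∀ x, ‖wd T w x‖ ≤ ‖x‖ / 2) (k : ℕ) :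
    ∀ w : List ι, w.length = n * k → ∀ x, ‖wd T w x‖ ≤ (1 / 2) ^ k * ‖x‖ := by
  induction k with
  | zero =>
    intro w hw x
    have : w = [] := by simpa using hw
    simp [this, wd_nil]
  | succ k ih =>
    intro w hw x
    rw [← List.take_append_drop n w, wd_append]
    have h1 := h (w.take n) (by rw [List.length_take, hw, mul_add]; omega)
      (wd T (w.drop n) x)
    have h2 := ih (w.drop n) (by rw [List.length_drop, hw, mul_add]; omega) x
    rw [pow_succ]
    linarith

theorem small_ext [NormedAddCommGroup E] [NormedSpace ℂ E]
    (T : ι → Module.End ℂ E) (hg : ∀ r : ℝ, 1 < r → Grow T r)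
    (W : Submodule ℂ E) [IsClosed (W : Set E)] (hW : ∀ i, ∀ x ∈ W, T i x ∈ W)
    (h1 : Small (resFam T W hW)) (h2 : Small (quoFam T W hW)) : Small T := by
  obtain ⟨n1, hn1, h1⟩ := h1
  obtain ⟨n2, hn2, h2⟩ := h2
  obtain ⟨r, hr, hrn⟩ := exists_root (n1 * n2)
  obtain ⟨C, hC, hg⟩ := hg r hr
  have hlim : Tendsto (fun k : ℕ => (5 * C) * (3 / 4 : ℝ) ^ k) atTop (nhds ((5 * C) * 0)) :=
    (tendsto_pow_atTop_nhds_zero_of_lt_one (by norm_num) (by norm_num)).const_mul _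
  rw [mul_zero] at hlim
  obtain ⟨k, hk, hk1⟩ := ((hlim.eventually (gt_mem_nhds (show (0 : ℝ) < 1 / 2 by norm_num))).and
    (eventually_ge_atTop 1)).exists
  have hpos : 1 ≤ n1 * n2 * k := Nat.mul_pos (Nat.mul_pos hn1 hn2) hk1
  refine ⟨n1 * n2 * k + n1 * n2 * k, by omega, fun w hw x => ?_⟩
  by_cases hx : x = 0
  · simp [hx]
  have hxn : 0 < ‖x‖ := norm_pos_iff.2 hx
  obtain ⟨u, hu⟩ : ∃ u, u = w.take (n1 * n2 * k) := ⟨_, rfl⟩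
  obtain ⟨v, hv⟩ : ∃ v, v = w.drop (n1 * n2 * k) := ⟨_, rfl⟩
  have hul : u.length = n1 * n2 * k := by rw [hu, List.length_take, hw]; omega
  have hvl : v.length = n1 * n2 * k := by rw [hv, List.length_drop, hw]; omega
  have huv : w = u ++ v := by rw [hu, hv, List.take_append_drop]
  have hhalf : ∀ m : ℕ, 1 ≤ m → (1 / 2 : ℝ) ^ (m * k) ≤ (1 / 2) ^ k := fun m hm =>
    pow_le_pow_of_le_one (by norm_num) (by norm_num) (Nat.le_mul_of_pos_left k hm)
  obtain ⟨h, hh⟩ : ∃ h : ℝ, h = (1 / 2) ^ k := ⟨_, rfl⟩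
  have hh0 : 0 < h := by rw [hh]; positivity
  have hh1 : h ≤ 1 := by rw [hh]; exact pow_le_one₀ (by norm_num) (by norm_num)
  obtain ⟨g, hgg⟩ : ∃ g : ℝ, g = (3 / 2) ^ k := ⟨_, rfl⟩
  have hg1 : 1 ≤ g := by rw [hgg]; exact one_le_pow₀ (by norm_num)
  have hA : ∀ z ∈ W, ‖wd T u z‖ ≤ h * ‖z‖ := by
    intro z hz
    have := small_iter (resFam T W hW) n1 h1 (n2 * k) u (by rw [hul, mul_assoc]) ⟨z, hz⟩
    rw [Submodule.coe_norm, wd_res] at this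
    refine this.trans ?_
    rw [hh]
    exact mul_le_mul_of_nonneg_right (hhalf n2 hn2) (norm_nonneg _)
  have hB : ‖(Submodule.Quotient.mk (wd T v x) : E ⧸ W)‖ ≤ h * ‖x‖ := by
    have := small_iter (quoFam T W hW) n2 h2 (n1 * k) v
      (by rw [hvl]; ring) (Submodule.Quotient.mk x)
    rw [wd_quo] at this
    refine this.trans ?_
    rw [hh]
    exact mul_le_mul (hhalf n1 hn1) (Submodule.Quotient.norm_mk_le W x) (norm_nonneg _)
      (by positivity)
  have hgrow : ∀ a : List ι, a.length = n1 * n2 * k → ∀ y, ‖wd T a y‖ ≤ C * g * ‖y‖ := by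
    intro a ha y
    refine (hg a y).trans ?_
    rw [ha, pow_mul, hgg]
    gcongr
  obtain ⟨e, he, hen⟩ := Submodule.Quotient.norm_mk_lt
    (Submodule.Quotient.mk (wd T v x) : E ⧸ W) (mul_pos hh0 hxn)
  have hz : wd T v x - e ∈ W := (Submodule.Quotient.eq W).1 he.symm
  have hsum : wd T w x = wd T u (wd T v x - e) + wd T u e := by
    rw [huv, wd_append, ← map_add, sub_add_cancel]
  have e1 : ‖e‖ ≤ 2 * h * ‖x‖ := by linarith
  have e2 : ‖wd T v x - e‖ ≤ C * g * ‖x‖ + 2 * h * ‖x‖ :=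
    (norm_sub_le _ _).trans (add_le_add (hgrow v hvl x) e1)
  have e3 : ‖wd T w x‖ ≤ h * (C * g * ‖x‖ + 2 * h * ‖x‖) + C * g * (2 * h * ‖x‖) := by
    rw [hsum]
    refine (norm_add_le _ _).trans (add_le_add ?_ ?_)
    · exact (hA _ hz).trans (by gcongr)
    · exact (hgrow u hul e).trans (by gcongr)
  have hCg : 1 ≤ C * g := one_le_mul_of_one_le_of_one_le hC hg1
  have hhg : h * g = (3 / 4) ^ k := by rw [hh, hgg, ← mul_pow]; norm_num
  have e4 : h * (C * g * ‖x‖ + 2 * h * ‖x‖) + C * g * (2 * h * ‖x‖) ≤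
      5 * C * (3 / 4) ^ k * ‖x‖ := by
    rw [← hhg]
    have : h * h * ‖x‖ ≤ h * (C * g) * ‖x‖ := by gcongr; linarith
    nlinarith
  have e5 : 5 * C * (3 / 4) ^ k * ‖x‖ ≤ 1 / 2 * ‖x‖ := by gcongr
  linarith

theorem good_main (n : ℕ) : ∀ (E : Type) [NormedAddCommGroup E] [NormedSpace ℂ E]
    [FiniteDimensional ℂ E] (T : ι → Module.End ℂ E), Module.finrank ℂ E = n →
    (∀ r : ℝ, 1 < r → Grow T r) → ¬ Small T → Good T := by
  induction n using Nat.strong_induction_on with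
  | _ n ih =>
  intro E _ _ _ T hn hg hs
  rcases subsingleton_or_nontrivial E with hE | hE
  · exact absurd ⟨1, le_rfl, fun w _ x => by
      rw [Subsingleton.elim x 0]; simp⟩ hs
  have hbot := bddSub_ne_bot T hg
  obtain ⟨W, hWdef⟩ : ∃ W, W = bddSub T := ⟨_, rfl⟩
  have hW : ∀ i, ∀ x ∈ W, T i x ∈ W := by rw [hWdef]; exact bddSub_inv T
  rw [← hWdef] at hbot
  have hcl : IsClosed (W : Set E) := W.closed_of_finiteDimensional
  by_cases h1 : Small (resFam T W hW)
  · have h2 : ¬ Small (quoFam T W hW) := fun h2 => hs (small_ext T hg W hW h1 h2)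
    refine good_of_quo T W hW (ih (Module.finrank ℂ (E ⧸ W)) ?_ (E ⧸ W) _ rfl ?_ h2)
    · have h3 := W.finrank_quotient_add_finrank
      have h4 : 0 < Module.finrank ℂ W := by
        have := (Submodule.nontrivial_iff_ne_bot).2 hbot
        exact Module.finrank_pos
      omega
    · intro r hr
      obtain ⟨C, hC, hgr⟩ := hg r hr
      refine ⟨C, hC, fun w x => ?_⟩
      refine le_of_forall_pos_le_add fun δ hδ => ?_
      have hc : 0 < C * r ^ w.length := by positivity
      obtain ⟨m, rfl, hm⟩ := Submodule.Quotient.norm_mk_lt x (div_pos hδ hc)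
      rw [wd_quo]
      calc _ ≤ ‖wd T w m‖ := Submodule.Quotient.norm_mk_le W _
        _ ≤ C * r ^ w.length * ‖m‖ := hgr w m
        _ ≤ C * r ^ w.length * (‖(Submodule.Quotient.mk m : E ⧸ W)‖ + δ / (C * r ^ w.length)) := by
          gcongr
        _ = _ := by rw [mul_add, mul_div_cancel₀ _ hc.ne']
  · refine good_of_res T W hW (good_of_bounded _ ?_ h1)
    have : CompleteSpace W := FiniteDimensional.complete ℂ W
    obtain ⟨C, hC⟩ := banach_steinhaus
      (g := fun w : List ι => LinearMap.toContinuousLinearMap (wd (resFam T W hW) w)) (by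
        intro x
        obtain ⟨C, hC⟩ : (x : E) ∈ bddSub T := hWdef ▸ x.2
        refine ⟨C, fun w => ?_⟩
        have := hC w
        rw [← wd_res T W hW] at this
        exact this)
    refine ⟨max C 1, le_max_right _ _, fun w x => ?_⟩
    rw [one_pow, mul_one]
    exact (ContinuousLinearMap.le_opNorm
      (LinearMap.toContinuousLinearMap (wd (resFam T W hW) w)) x).trans
      (mul_le_mul_of_nonneg_right ((hC w).trans (le_max_left _ _)) (norm_nonneg _))

theorem wd_replicate [AddCommGroup E] [Module ℂ E] (T : ι → Module.End ℂ E) (w : List ι) (k : ℕ) :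
    ∃ u : List ι, u.length = w.length * k ∧ wd T u = (wd T w) ^ k := by
  induction k with
  | zero => exact ⟨[], by simp, by simp [wd]⟩
  | succ k ih =>
    obtain ⟨u, hu, hu2⟩ := ih
    refine ⟨u ++ w, by rw [List.length_append, hu, mul_add, mul_one], ?_⟩
    rw [pow_succ, ← hu2]
    simp [wd]

theorem pow_bound {a b C : ℝ} (hb : 0 < b) (h : ∀ k : ℕ, a ^ k ≤ C * b ^ k) :
    a ≤ b := by
  by_contra hab
  push Not at hab
  have h1 : 1 < a / b := by rwa [one_lt_div hb]
  obtain ⟨k, hk⟩ := pow_unbounded_of_one_lt C h1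
  rw [div_pow, lt_div_iff₀ (by positivity)] at hk
  exact absurd (h k) (not_le.2 hk)

theorem eig_le [NormedAddCommGroup E] [NormedSpace ℂ E]
    (T : ι → Module.End ℂ E) (hg : ∀ r : ℝ, 1 < r → Grow T r) (w : List ι) (μ : ℂ)
    (hμ : (wd T w).HasEigenvalue μ) : ‖μ‖ ≤ 1 := by
  obtain ⟨x, hx⟩ := hμ.exists_hasEigenvector
  have hxn : 0 < ‖x‖ := norm_pos_iff.2 hx.2
  have key : ∀ r : ℝ, 1 < r → ‖μ‖ ≤ r ^ w.length := by
    intro r hr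
    obtain ⟨C, hC, hg⟩ := hg r hr
    refine pow_bound (C := C) (by positivity) fun k => ?_
    obtain ⟨u, hu, hu2⟩ := wd_replicate T w k
    have h1 := hg u x
    rw [hu2, hx.pow_apply, norm_smul, norm_pow, hu, pow_mul] at h1
    exact le_of_mul_le_mul_right h1 hxn
  have hlim : Tendsto (fun r : ℝ => r ^ w.length) (nhdsWithin 1 (Set.Ioi 1)) (nhds 1) := by
    have : Continuous fun r : ℝ => r ^ w.length := by fun_prop
    have h2 := this.tendsto 1
    rw [one_pow] at h2
    exact h2.mono_left nhdsWithin_le_nhds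
  exact ge_of_tendsto hlim (by filter_upwards [self_mem_nhdsWithin] with r hr using key r hr)

theorem letters_bound [NormedAddCommGroup E] [NormedSpace ℂ E]
    (T : ι → Module.End ℂ E) (M : ℝ) (hM : 0 ≤ M) (hT : ∀ i x, ‖T i x‖ ≤ M * ‖x‖)
    (w : List ι) (x : E) : ‖wd T w x‖ ≤ M ^ w.length * ‖x‖ := by
  induction w with
  | nil => simp [wd_nil]
  | cons i w ih =>
    rw [wd_cons, List.length_cons, pow_succ']
    calc _ ≤ M * ‖wd T w x‖ := hT i _
      _ ≤ M * (M ^ w.length * ‖x‖) := by gcongr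
      _ = _ := by ring

theorem grow_of [NormedAddCommGroup E] [NormedSpace ℂ E]
    (T : ι → Module.End ℂ E) (M : ℝ) (hM : 1 ≤ M) (hT : ∀ i x, ‖T i x‖ ≤ M * ‖x‖)
    (r : ℝ) (hr : 1 < r) (n : ℕ) (hn : 1 ≤ n)
    (h : ∀ w : List ι, w.length = n → ∀ x, ‖wd T w x‖ ≤ r ^ n * ‖x‖) : Grow T r := by
  refine ⟨M ^ n, one_le_pow₀ hM, ?_⟩
  suffices H : ∀ m : ℕ, ∀ w : List ι, w.length = m → ∀ x, ‖wd T w x‖ ≤ M ^ n * r ^ m * ‖x‖ from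
    fun w x => H _ w rfl x
  intro m
  induction m using Nat.strong_induction_on with
  | _ m ih =>
  intro w hw x
  rcases lt_or_ge m n with hmn | hmn
  · refine (letters_bound T M (by linarith) hT w x).trans ?_
    have h1 : M ^ w.length ≤ M ^ n := pow_le_pow_right₀ hM (by omega)
    have h2 : 1 ≤ r ^ m := one_le_pow₀ hr.le
    have h3 : M ^ n * 1 ≤ M ^ n * r ^ m := by gcongr
    gcongr
    linarith
  · rw [← List.take_append_drop n w, wd_append]
    have h1 := h (w.take n) (by rw [List.length_take]; omega) (wd T (w.drop n) x)
    have h2 := ih (m - n) (by omega) (w.drop n) (by rw [List.length_drop]; omega) x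
    calc _ ≤ _ := h1
      _ ≤ r ^ n * (M ^ n * r ^ (m - n) * ‖x‖) := by gcongr
      _ = M ^ n * (r ^ n * r ^ (m - n)) * ‖x‖ := by ring
      _ = _ := by rw [← pow_add, Nat.add_sub_cancel' hmn]

theorem mem_pow_iff {d : ℕ} (S : Set (Matrix (Fin d) (Fin d) ℂ)) (n : ℕ)
    (A : Matrix (Fin d) (Fin d) ℂ) :
    A ∈ S ^ n ↔ ∃ w : List S, w.length = n ∧ (w.map Subtype.val).prod = A := by
  rw [Set.mem_pow]
  constructor
  · rintro ⟨f, rfl⟩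
    refine ⟨List.ofFn f, by simp, ?_⟩
    rw [List.map_ofFn]
    rfl
  · rintro ⟨w, rfl, rfl⟩
    refine ⟨w.get, ?_⟩
    congr 1
    conv_rhs => rw [← List.ofFn_get w, List.map_ofFn]
    rfl

/-- The rescaled family attached to a set of matrices. -/
noncomputable def fam {d : ℕ} (S : Set (Matrix (Fin d) (Fin d) ℂ)) (ρ : ℝ) :
    S → Module.End ℂ (Fin d → ℂ) :=
  fun s => ((ρ⁻¹ : ℝ) : ℂ) • Matrix.toLin' (s : Matrix (Fin d) (Fin d) ℂ)

theorem wd_fam {d : ℕ} (S : Set (Matrix (Fin d) (Fin d) ℂ)) (ρ : ℝ) (w : List S) :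
    wd (fam S ρ) w = (((ρ⁻¹ : ℝ) : ℂ) ^ w.length) •
      Matrix.toLin' (w.map Subtype.val).prod := by
  induction w with
  | nil => simp [wd]; rfl
  | cons s w ih =>
    have : wd (fam S ρ) (s :: w) = fam S ρ s * wd (fam S ρ) w := by simp [wd]
    rw [this, ih, List.map_cons, List.prod_cons, Matrix.toLin'_mul, fam, List.length_cons, pow_succ',
      smul_mul_smul_comm]
    rfl

theorem norm_fam {d : ℕ} (S : Set (Matrix (Fin d) (Fin d) ℂ)) (ρ : ℝ) (hρ : 0 < ρ) (w : List S)
    (x : Fin d → ℂ) : ‖(w.map Subtype.val).prod.mulVec x‖ =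
      ρ ^ w.length * ‖wd (fam S ρ) w x‖ := by
  rw [wd_fam, LinearMap.smul_apply, norm_smul, Matrix.toLin'_apply, ← mul_assoc]
  have : ρ ^ w.length * ‖((ρ⁻¹ : ℝ) : ℂ) ^ w.length‖ = 1 := by
    rw [norm_pow, Complex.norm_real, norm_inv, Real.norm_of_nonneg hρ.le, ← mul_pow,
      mul_inv_cancel₀ hρ.ne', one_pow]
  rw [this, one_mul]

theorem opNorm_le_of {d : ℕ} (A : Matrix (Fin d) (Fin d) ℂ) (c : ℝ) (hc : 0 ≤ c)
    (h : ∀ x, ‖A.mulVec x‖ ≤ c * ‖x‖) : opNorm stdNorm A ≤ c := by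
  refine Real.sSup_le ?_ hc
  rintro _ ⟨x, hx, rfl⟩
  exact (h x).trans (mul_le_of_le_one_right hc hx)

theorem le_opNorm_mul {d : ℕ} (A : Matrix (Fin d) (Fin d) ℂ) (x : Fin d → ℂ) :
    ‖A.mulVec x‖ ≤ opNorm stdNorm A * ‖x‖ := by
  by_cases hx : x = 0
  · simp [hx]
  have hxn : 0 < ‖x‖ := norm_pos_iff.2 hx
  have hb : BddAbove {c : ℝ | ∃ x : Fin d → ℂ, stdNorm x ≤ 1 ∧ c = stdNorm (A.mulVec x)} := by
    refine ⟨‖LinearMap.toContinuousLinearMap (Matrix.toLin' A)‖, ?_⟩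
    rintro _ ⟨y, hy, rfl⟩
    exact ((LinearMap.toContinuousLinearMap (Matrix.toLin' A)).le_opNorm y).trans
      (mul_le_of_le_one_right (norm_nonneg _) hy)
  have h1 : stdNorm (A.mulVec (((‖x‖⁻¹ : ℝ) : ℂ) • x)) ≤ opNorm stdNorm A :=
    le_csSup hb ⟨_, by simp [stdNorm, norm_smul, hxn.ne'], rfl⟩
  rw [Matrix.mulVec_smul, stdNorm, norm_smul, Complex.norm_real, norm_inv, norm_norm,
    inv_mul_eq_div, div_le_iff₀ hxn] at h1
  exact h1

theorem opNorm_nonneg {d : ℕ} (A : Matrix (Fin d) (Fin d) ℂ) : 0 ≤ opNorm stdNorm A := by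
  refine Real.sSup_nonneg ?_
  rintro _ ⟨x, -, rfl⟩
  exact norm_nonneg _

theorem setOpNorm_nonneg {d : ℕ} (S : Set (Matrix (Fin d) (Fin d) ℂ)) :
    0 ≤ setOpNorm stdNorm S := by
  refine Real.sSup_nonneg ?_
  rintro _ ⟨A, -, rfl⟩
  exact opNorm_nonneg A

theorem jsr_pow_le {d : ℕ} (S : Set (Matrix (Fin d) (Fin d) ℂ)) (hρ : 0 < jsr S) (n : ℕ) :
    jsr S ^ (n + 1) ≤ setOpNorm stdNorm (S ^ (n + 1)) := by
  have h1 : jsr S ≤ setOpNorm stdNorm (S ^ (n + 1)) ^ (1 / (n + 1 : ℝ)) := by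
    refine ciInf_le (f := fun n : ℕ => setOpNorm stdNorm (S ^ (n + 1)) ^ (1 / (n + 1 : ℝ)))
      ⟨0, ?_⟩ n
    rintro _ ⟨m, rfl⟩
    exact Real.rpow_nonneg (setOpNorm_nonneg _) _
  calc _ ≤ (setOpNorm stdNorm (S ^ (n + 1)) ^ (1 / (n + 1 : ℝ))) ^ (n + 1) :=
        pow_le_pow_left₀ hρ.le h1 _
    _ = _ := by
      rw [← Real.rpow_natCast, ← Real.rpow_mul (setOpNorm_nonneg _)]
      push_cast
      rw [one_div, inv_mul_cancel₀ (by positivity), Real.rpow_one]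

theorem not_small_fam {d : ℕ} (S : Set (Matrix (Fin d) (Fin d) ℂ)) (hρ : 0 < jsr S) :
    ¬ Small (fam S (jsr S)) := by
  rintro ⟨n, hn, h⟩
  obtain ⟨m, rfl⟩ : ∃ m, n = m + 1 := ⟨n - 1, by omega⟩
  have h1 := jsr_pow_le S hρ m
  have h2 : setOpNorm stdNorm (S ^ (m + 1)) ≤ jsr S ^ (m + 1) / 2 := by
    refine Real.sSup_le ?_ (by positivity)
    rintro _ ⟨A, hA, rfl⟩
    obtain ⟨w, hw, rfl⟩ := (mem_pow_iff _ _ _).1 hA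
    refine opNorm_le_of _ _ (by positivity) fun x => ?_
    rw [norm_fam S _ hρ, hw]
    have := mul_le_mul_of_nonneg_left (h w hw x) (pow_pos hρ (m + 1)).le
    linarith
  have : 0 < jsr S ^ (m + 1) := by positivity
  linarith

theorem fam_letters {d : ℕ} (S : Set (Matrix (Fin d) (Fin d) ℂ)) (hS : MatBdd S) (ρ : ℝ)
    (hρ : 0 < ρ) : ∃ M : ℝ, 1 ≤ M ∧ ∀ i x, ‖fam S ρ i x‖ ≤ M * ‖x‖ := by
  obtain ⟨C, hC⟩ := hS
  refine ⟨max 1 (ρ⁻¹ * (d * C)), le_max_left _ _, fun i x => ?_⟩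
  have h1 : ‖(i : Matrix (Fin d) (Fin d) ℂ).mulVec x‖ ≤ d * |C| * ‖x‖ := by
    refine (pi_norm_le_iff_of_nonneg (by positivity)).2 fun a => ?_
    rw [Matrix.mulVec, dotProduct]
    refine (norm_sum_le _ _).trans ?_
    calc _ ≤ ∑ b : Fin d, |C| * ‖x‖ := Finset.sum_le_sum fun b _ => by
          rw [norm_mul]
          exact mul_le_mul ((hC i i.2 a b).trans (le_abs_self C)) (norm_le_pi_norm x b)
            (norm_nonneg _) (abs_nonneg _)
      _ = _ := by simp [mul_assoc]
  have h3 : ρ⁻¹ * (d * |C|) ≤ max 1 (ρ⁻¹ * (d * C)) := by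
    rcases Nat.eq_zero_or_pos d with hd | hd
    · simp [hd]
    · rw [abs_of_nonneg ((norm_nonneg _).trans (hC i i.2 ⟨0, hd⟩ ⟨0, hd⟩))]
      exact le_max_right _ _
  rw [fam, LinearMap.smul_apply, norm_smul, Matrix.toLin'_apply, Complex.norm_real, norm_inv,
    Real.norm_of_nonneg hρ.le]
  calc _ ≤ ρ⁻¹ * (d * |C| * ‖x‖) := by gcongr
    _ = ρ⁻¹ * (d * |C|) * ‖x‖ := by ring
    _ ≤ _ := by gcongr

theorem grow_fam {d : ℕ} (S : Set (Matrix (Fin d) (Fin d) ℂ)) (hS : MatBdd S) (hρ : 0 < jsr S)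
    (r : ℝ) (hr : 1 < r) : Grow (fam S (jsr S)) r := by
  obtain ⟨M, hM, hMb⟩ := fam_letters S hS (jsr S) hρ
  have hlt : jsr S < r * jsr S := by nlinarith
  obtain ⟨n, hn⟩ := exists_lt_of_ciInf_lt
    (f := fun n : ℕ => setOpNorm stdNorm (S ^ (n + 1)) ^ (1 / (n + 1 : ℝ))) hlt
  refine grow_of _ M hM hMb r hr (n + 1) (by omega) fun w hw x => ?_
  have h1 : setOpNorm stdNorm (S ^ (n + 1)) ≤ (r * jsr S) ^ (n + 1) := by
    calc _ = (setOpNorm stdNorm (S ^ (n + 1)) ^ (1 / (n + 1 : ℝ))) ^ (n + 1) := by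
          rw [← Real.rpow_natCast, ← Real.rpow_mul (setOpNorm_nonneg _)]
          push_cast
          rw [one_div, inv_mul_cancel₀ (by positivity), Real.rpow_one]
      _ ≤ _ := pow_le_pow_left₀ (Real.rpow_nonneg (setOpNorm_nonneg _) _) hn.le _
  have hbd : BddAbove (opNorm stdNorm '' (S ^ (n + 1))) := by
    refine ⟨jsr S ^ (n + 1) * M ^ (n + 1), ?_⟩
    rintro _ ⟨A, hA, rfl⟩
    obtain ⟨v, hv, rfl⟩ := (mem_pow_iff _ _ _).1 hA
    refine opNorm_le_of _ _ (by positivity) fun x => ?_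
    rw [norm_fam S _ hρ, hv, mul_assoc]
    have := letters_bound _ M (by linarith) hMb v x
    rw [hv] at this
    gcongr
  have h2 : opNorm stdNorm (w.map Subtype.val).prod ≤
      (r * jsr S) ^ (n + 1) :=
    (le_csSup hbd ⟨_, (mem_pow_iff _ _ _).2 ⟨w, hw, rfl⟩, rfl⟩).trans h1
  have h3 := (le_opNorm_mul (w.map Subtype.val).prod x).trans
    (mul_le_mul_of_nonneg_right h2 (norm_nonneg x))
  rw [norm_fam S _ hρ, hw, mul_pow] at h3
  have hp : 0 < jsr S ^ (n + 1) := by positivity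
  refine le_of_mul_le_mul_left ?_ hp
  linarith

theorem spec_fam {d : ℕ} (S : Set (Matrix (Fin d) (Fin d) ℂ)) (ρ : ℝ) (hρ : 0 < ρ) (w : List S)
    (μ : ℂ) : (wd (fam S ρ) w).HasEigenvalue μ ↔
      (ρ : ℂ) ^ w.length * μ ∈ spectrum ℂ (w.map Subtype.val).prod := by
  have hne : (ρ : ℂ) ^ w.length ≠ 0 := pow_ne_zero _ (by exact_mod_cast hρ.ne')
  rw [← Matrix.spectrum_toLin', ← Module.End.hasEigenvalue_iff_mem_spectrum]
  have key : ∀ x, Matrix.toLin' (w.map Subtype.val).prod x =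
      (ρ : ℂ) ^ w.length • wd (fam S ρ) w x := by
    intro x
    rw [wd_fam, LinearMap.smul_apply, smul_smul]
    have : (ρ : ℂ) ^ w.length * ((ρ⁻¹ : ℝ) : ℂ) ^ w.length = 1 := by
      rw [Complex.ofReal_inv, ← mul_pow, mul_inv_cancel₀ (by exact_mod_cast hρ.ne'), one_pow]
    rw [this, one_smul]
  constructor
  · intro h
    obtain ⟨x, hx⟩ := h.exists_hasEigenvector
    refine Module.End.hasEigenvalue_of_hasEigenvector (x := x) ?_
    rw [Module.End.hasEigenvector_iff, Module.End.mem_eigenspace_iff] at hx ⊢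
    exact ⟨by rw [key, hx.1, smul_smul], hx.2⟩
  · intro h
    obtain ⟨x, hx⟩ := h.exists_hasEigenvector
    refine Module.End.hasEigenvalue_of_hasEigenvector (x := x) ?_
    rw [Module.End.hasEigenvector_iff, Module.End.mem_eigenspace_iff] at hx ⊢
    refine ⟨?_, hx.2⟩
    have h1 := hx.1
    rw [key, mul_smul] at h1
    exact smul_right_injective _ hne h1

end JSRAux

/-- if `S` is bounded with `ρ(S) > 0`, then
`limsup_{n→∞} Λ(Sⁿ)/ρ(S)ⁿ = 1`. -/
theorem stmt_9 {d : ℕ} (S : Set (Matrix (Fin d) (Fin d) ℂ)) (hS : MatBdd S)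
    (hρ : 0 < jsr S) :
    Filter.limsup (fun n : ℕ => lamSet (S ^ (n + 1)) / jsr S ^ (n + 1)) atTop = 1 := by
  have hg := JSRAux.grow_fam S hS hρ
  have hgood := JSRAux.good_main _ _ (JSRAux.fam S (jsr S)) rfl hg (JSRAux.not_small_fam S hρ)
  -- every eigenvalue of a product is bounded
  have hev : ∀ n : ℕ, ∀ A ∈ S ^ n, ∀ μ ∈ spectrum ℂ A, ‖μ‖ ≤ jsr S ^ n := by
    intro n A hA μ hμ
    obtain ⟨w, rfl, rfl⟩ := (JSRAux.mem_pow_iff _ _ _).1 hA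
    have hne : (jsr S : ℂ) ^ w.length ≠ 0 := pow_ne_zero _ (by exact_mod_cast hρ.ne')
    have h1 := (JSRAux.spec_fam S (jsr S) hρ w (μ / (jsr S : ℂ) ^ w.length)).2
      (by rwa [mul_div_cancel₀ _ hne])
    have h2 := JSRAux.eig_le _ hg w _ h1
    rw [norm_div, norm_pow, Complex.norm_real, Real.norm_of_nonneg hρ.le,
      div_le_one (by positivity)] at h2
    exact h2
  have hsr : ∀ n : ℕ, ∀ A ∈ S ^ n, specRad A ≤ jsr S ^ n := by
    intro n A hA
    refine Real.sSup_le ?_ (by positivity)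
    rintro _ ⟨μ, hμ, rfl⟩
    exact hev n A hA μ hμ
  have hlam : ∀ n : ℕ, lamSet (S ^ n) ≤ jsr S ^ n := by
    intro n
    refine Real.sSup_le ?_ (by positivity)
    rintro _ ⟨A, hA, rfl⟩
    exact hsr n A hA
  have hle1 : ∀ n : ℕ, lamSet (S ^ (n + 1)) / jsr S ^ (n + 1) ≤ 1 := fun n => by
    rw [div_le_one (by positivity)]
    exact hlam _
  have hge0 : ∀ n : ℕ, 0 ≤ lamSet (S ^ (n + 1)) / jsr S ^ (n + 1) := fun n => by
    refine div_nonneg (Real.sSup_nonneg ?_) (by positivity)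
    rintro _ ⟨A, -, rfl⟩
    refine Real.sSup_nonneg ?_
    rintro _ ⟨μ, -, rfl⟩
    exact norm_nonneg _
  have hbdd : IsBoundedUnder (· ≤ ·) atTop
      (fun n : ℕ => lamSet (S ^ (n + 1)) / jsr S ^ (n + 1)) :=
    isBoundedUnder_of ⟨1, hle1⟩
  have hcob : IsCoboundedUnder (· ≤ ·) atTop
      (fun n : ℕ => lamSet (S ^ (n + 1)) / jsr S ^ (n + 1)) :=
    (isBoundedUnder_of ⟨0, hge0⟩ : IsBoundedUnder (· ≥ ·) atTop _).isCoboundedUnder_le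
  refine le_antisymm (limsup_le_of_le hcob (Eventually.of_forall hle1)) ?_
  refine le_of_forall_sub_le fun ε hε => ?_
  refine le_limsup_of_frequently_le ?_ hbdd
  rw [frequently_atTop]
  intro N
  obtain ⟨w, hw, μ, hμ, hn⟩ := hgood ε hε (N + 1)
  obtain ⟨m, hm⟩ : ∃ m, w.length = m + 1 := ⟨w.length - 1, by omega⟩
  refine ⟨m, by omega, ?_⟩
  rw [le_div_iff₀ (by positivity)]
  have h1 := (JSRAux.spec_fam S (jsr S) hρ w μ).1 hμ
  have hmem := (JSRAux.mem_pow_iff S (m + 1) _).2 ⟨w, hm, rfl⟩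
  have h2 : ‖(jsr S : ℂ) ^ w.length * μ‖ ≤
      specRad (w.map Subtype.val).prod :=
    le_csSup ⟨jsr S ^ (m + 1), by
      rintro _ ⟨ν, hν, rfl⟩
      exact hev _ _ hmem ν hν⟩ ⟨_, h1, rfl⟩
  have h3 : specRad (w.map Subtype.val).prod ≤
      lamSet (S ^ (m + 1)) :=
    le_csSup ⟨jsr S ^ (m + 1), by
      rintro _ ⟨A, hA, rfl⟩
      exact hsr _ A hA⟩ ⟨_, hmem, rfl⟩
  rw [norm_mul, norm_pow, Complex.norm_real, Real.norm_of_nonneg hρ.le, hm] at h2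
  have h4 : (1 - ε) * jsr S ^ (m + 1) ≤ jsr S ^ (m + 1) * ‖μ‖ := by
    rw [mul_comm]
    gcongr
  linarith
end
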